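/- Fix integers m ≥ 2, n ≥ 4, and 1 ≤ h ≤ n − 3. There exists a constant C > 0 such that for every finite field F with q elements (where, if m > 2, the characteristic of F is assumed greater than n), | (1/q^n) · Σ_{f ∈ M_n(F)} ( Σ_{g ∈ F[x], deg g ≤ h} μ(f + g) )^m | ≤ C·q^{(h+1)(m−1)}. -/

import Mathlib

open scoped Classical

/-- The Möbius function for polynomials over a field: `μ f = (-1) ^ k` if `f` is squarefree
with exactly `k` monic irreducible factors, and `μ f = 0` otherwise. -/
noncomputable def polyMoebius {F : Type*} [Field F] (f : Polynomial F) : ℤ :=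
  if Squarefree f then
    (-1) ^ Multiset.card (UniqueFactorizationMonoid.normalizedFactors f) else 0

/-- The monic polynomial `X ^ n + ∑_{j < n} c j * X ^ j`; as `c` ranges over `Fin n → F`
this enumerates the monic polynomials of degree `n` exactly once. -/
noncomputable def monicOfCoeffs {F : Type*} [Field F] (n : ℕ) (c : Fin n → F) : Polynomial F :=
  Polynomial.X ^ n + ∑ j : Fin n, Polynomial.C (c j) * Polynomial.X ^ (j : ℕ)

section WeightedBasis

variable {K R Γ E : Type*} [Field K] [CommRing R] [Algebra K R]
  [LinearOrderedCommGroupWithZero Γ]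

/-- Elements with pairwise distinct valuations satisfy the equality case of the ultrametric
inequality. -/
lemma exists_valuation_sum_eq {ι : Type*} (v : Valuation R Γ)
    (hv : ∀ x : K, x ≠ 0 → v (algebraMap K R x) = 1) {γ : Γ} (hγ : 1 < γ)
    {u : ι → R} {w : ι → ℕ} (hu : ∀ i, v (u i) = γ ^ w i) (hw : Function.Injective w)
    (s : Finset ι) (x : ι → K) (hx : ∃ i ∈ s, x i ≠ 0) :
    ∃ i ∈ s, x i ≠ 0 ∧ v (∑ j ∈ s, x j • u j) = γ ^ w i ∧
      ∀ j ∈ s, x j ≠ 0 → w j ≤ w i := by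
  have hγ0 : γ ≠ 0 := (zero_lt_one.trans hγ).ne'
  obtain ⟨i, hi, hmax⟩ := Finset.exists_max_image (s.filter (fun i => x i ≠ 0)) w
    (by obtain ⟨i, hi, h⟩ := hx; exact ⟨i, by simp [hi, h]⟩)
  simp only [Finset.mem_filter, and_imp] at hi hmax
  refine ⟨i, hi.1, hi.2, ?_, hmax⟩
  have hterm : ∀ j, x j ≠ 0 → v (x j • u j) = γ ^ w j := fun j hj => by
    rw [Algebra.smul_def, map_mul, hv _ hj, hu, one_mul]
  rw [← Finset.add_sum_erase s _ hi.1, Valuation.map_add_eq_of_lt_left, hterm i hi.2]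
  rw [hterm i hi.2]
  refine v.map_sum_lt (pow_ne_zero _ hγ0) fun j hj => ?_
  rw [Finset.mem_erase] at hj
  by_cases hxj : x j = 0
  · simpa [hxj] using pow_pos (zero_lt_one.trans hγ) _
  · rw [hterm j hxj]
    exact pow_lt_pow_right₀ hγ (lt_of_le_of_ne (hmax j hj.2 hxj) fun h => hj.1 (hw h))

/-- A spanning family of a `K`-algebra whose members have pairwise distinct valuations, all of them
powers of a fixed element, with exponents omitting no number that is at least `gap`. -/
structure WeightedBasis (K R Γ E : Type*) [Field K] [CommRing R] [Algebra K R]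
    [LinearOrderedCommGroupWithZero Γ] where
  v : Valuation R Γ
  v_const : ∀ x : K, x ≠ 0 → v (algebraMap K R x) = 1
  γ : Γ
  one_lt : 1 < γ
  b : E → R
  wt : E → ℕ
  v_b : ∀ e, v (b e) = γ ^ wt e
  wt_inj : Function.Injective wt
  span : ⊤ ≤ Submodule.span K (Set.range b)
  gap : ℕ
  exists_wt : ∀ n, gap ≤ n → ∃ e, wt e = n

namespace WeightedBasis

variable (𝔅 : WeightedBasis K R Γ E)

/-- The indices of weight at most `n`. -/
abbrev Idx (n : ℕ) : Type _ := {e : E // 𝔅.wt e ≤ n}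

noncomputable instance (n : ℕ) : Fintype (𝔅.Idx n) :=
  Fintype.ofInjective (fun e => (⟨𝔅.wt e.1, Nat.lt_succ_of_le e.2⟩ : Fin (n + 1)))
    fun e e' h => Subtype.ext (𝔅.wt_inj (by simpa using h))

lemma card_idx_add_le (n d : ℕ) :
    Fintype.card (𝔅.Idx (n + d)) ≤ Fintype.card (𝔅.Idx n) + d := by
  have : Function.Injective (fun e : 𝔅.Idx (n + d) =>
      if h : 𝔅.wt e.1 ≤ n then (Sum.inl ⟨e.1, h⟩ : 𝔅.Idx n ⊕ Fin d)
      else Sum.inr ⟨𝔅.wt e.1 - (n + 1), by have := e.2; omega⟩) := by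
    intro e e' h
    dsimp only at h
    split_ifs at h with h1 h2 h2
    · simpa [Subtype.ext_iff] using h
    · simp only [Sum.inr.injEq, Fin.mk.injEq] at h
      exact Subtype.ext (𝔅.wt_inj (by omega))
  simpa using Fintype.card_le_of_injective _ this

lemma card_idx_le (n : ℕ) : Fintype.card (𝔅.Idx n) ≤ n + 1 := by
  have : Function.Injective
      (fun e : 𝔅.Idx n => (⟨𝔅.wt e.1, Nat.lt_succ_of_le e.2⟩ : Fin (n + 1))) :=
    fun e e' h => Subtype.ext (𝔅.wt_inj (by simpa using h))
  simpa using Fintype.card_le_of_injective _ this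

lemma le_card_idx (n : ℕ) : n + 1 - 𝔅.gap ≤ Fintype.card (𝔅.Idx n) := by
  choose f hf using 𝔅.exists_wt
  have : Function.Injective (fun i : Fin (n + 1 - 𝔅.gap) =>
      (⟨f (𝔅.gap + i) (by omega), by rw [hf]; omega⟩ : 𝔅.Idx n)) := by
    intro i j h
    have h' := congrArg (fun e : 𝔅.Idx n => 𝔅.wt e.1) h
    simp only [hf] at h'
    exact Fin.ext (by omega)
  simpa using Fintype.card_le_of_injective _ this

lemma linearIndependent : LinearIndependent K 𝔅.b := by
  rw [linearIndependent_iff']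
  intro s x hx i hi
  by_contra hne
  obtain ⟨j, -, -, hj, -⟩ := exists_valuation_sum_eq 𝔅.v 𝔅.v_const 𝔅.one_lt 𝔅.v_b 𝔅.wt_inj s x
    ⟨i, hi, hne⟩
  rw [hx, map_zero] at hj
  exact pow_ne_zero _ (zero_lt_one.trans 𝔅.one_lt).ne' hj.symm

/-- The underlying basis. -/
noncomputable def basis : Module.Basis E K R := Module.Basis.mk 𝔅.linearIndependent 𝔅.span

lemma exists_v_eq {f : R} (hf : f ≠ 0) :
    ∃ i, 𝔅.v f = 𝔅.γ ^ 𝔅.wt i ∧ ∀ e, 𝔅.basis.repr f e ≠ 0 → 𝔅.wt e ≤ 𝔅.wt i := by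
  have hne : 𝔅.basis.repr f ≠ 0 := by simpa using hf
  obtain ⟨e, he⟩ := Finsupp.ne_iff.1 hne
  obtain ⟨i, -, -, hi, hmax⟩ := exists_valuation_sum_eq 𝔅.v 𝔅.v_const 𝔅.one_lt 𝔅.v_b 𝔅.wt_inj
    (𝔅.basis.repr f).support (𝔅.basis.repr f) ⟨e, by simpa using he, he⟩
  have hsum : ∑ j ∈ (𝔅.basis.repr f).support, 𝔅.basis.repr f j • 𝔅.b j = f := by
    conv_rhs => rw [← 𝔅.basis.linearCombination_repr f]
    simp [Finsupp.linearCombination_apply, Finsupp.sum, basis]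
  exact ⟨i, hsum ▸ hi, fun e he => hmax e (by simpa using he) he⟩

lemma pow_γ_ne_zero (n : ℕ) : 𝔅.γ ^ n ≠ 0 := pow_ne_zero _ (zero_lt_one.trans 𝔅.one_lt).ne'

lemma v_ne_zero {f : R} (hf : f ≠ 0) : 𝔅.v f ≠ 0 := by
  obtain ⟨i, hi, -⟩ := 𝔅.exists_v_eq hf
  exact hi ▸ 𝔅.pow_γ_ne_zero _

lemma repr_eq_zero {f : R} {n : ℕ} (hf : 𝔅.v f ≤ 𝔅.γ ^ n) {e : E} (he : n < 𝔅.wt e) :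
    𝔅.basis.repr f e = 0 := by
  by_contra hne
  obtain ⟨i, hi, hmax⟩ := 𝔅.exists_v_eq (f := f) (by rintro rfl; simp at hne)
  rw [hi] at hf
  have h1 := (pow_le_pow_iff_right₀ 𝔅.one_lt).1 hf
  have h2 := hmax e hne
  omega

lemma exists_v_le (f : R) : ∃ n, 𝔅.v f ≤ 𝔅.γ ^ n := by
  by_cases hf : f = 0
  · exact ⟨0, by simp [hf]⟩
  · obtain ⟨i, hi, -⟩ := 𝔅.exists_v_eq hf
    exact ⟨_, hi.le⟩

/-- The elements of valuation at most `γ ^ n` form a space of dimension at most the number of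
basis elements of weight at most `n`. -/
lemma exists_ne_zero_map_eq_zero {V : Type*} [AddCommGroup V] [Module K V] [FiniteDimensional K V]
    (f : V →ₗ[K] R) (n : ℕ) (hf : ∀ x, 𝔅.v (f x) ≤ 𝔅.γ ^ n)
    (hV : Fintype.card (𝔅.Idx n) < Module.finrank K V) : ∃ x, x ≠ 0 ∧ f x = 0 := by
  let g : V →ₗ[K] (𝔅.Idx n → K) :=
    LinearMap.pi fun e => (Finsupp.lapply e.1) ∘ₗ 𝔅.basis.repr.toLinearMap ∘ₗ f
  have hker : LinearMap.ker g ≠ ⊥ := by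
    apply LinearMap.ker_ne_bot_of_finrank_lt
    simpa using hV
  obtain ⟨x, hx, hx0⟩ := (Submodule.ne_bot_iff _).1 hker
  refine ⟨x, hx0, ?_⟩
  apply 𝔅.basis.repr.injective
  ext e
  rw [map_zero, Finsupp.zero_apply]
  by_cases he : 𝔅.wt e ≤ n
  · exact congrFun hx ⟨e, he⟩
  · exact 𝔅.repr_eq_zero (hf x) (not_le.1 he)

lemma v_smul_le (x : K) (f : R) : 𝔅.v (x • f) ≤ 𝔅.v f := by
  by_cases hx : x = 0
  · simp [hx]
  · rw [Algebra.smul_def, map_mul, 𝔅.v_const x hx, one_mul]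

/-- A nonzero element of valuation at most `γ ^ d` has at most `d` zeros. -/
lemma card_zeros_le {H : R} (hH : H ≠ 0) {d : ℕ} (hd : 𝔅.v H ≤ 𝔅.γ ^ d)
    (S : Finset (R →ₐ[K] K)) (hS : ∀ P ∈ S, P H = 0) : S.card ≤ d := by
  by_contra! hlt
  have hsep : ∀ P P' : R →ₐ[K] K, ∃ r : R, P ≠ P' → P r ≠ P' r := fun P P' => by
    by_cases h : P = P'
    · exact ⟨0, fun h' => (h' h).elim⟩
    · obtain ⟨r, hr⟩ := DFunLike.ne_iff.1 h
      exact ⟨r, fun _ => hr⟩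
  choose r hr using hsep
  let ε : S → R := fun P => ∏ P' ∈ S.erase P.1, (r P.1 P' - algebraMap K R (P' (r P.1 P')))
  have hε0 : ∀ P P' : S, P ≠ P' → P'.1 (ε P) = 0 := fun P P' h => by
    rw [map_prod]
    refine Finset.prod_eq_zero (i := P'.1) ?_ (by simp)
    exact Finset.mem_erase.2 ⟨fun h' => h (Subtype.ext h'.symm), P'.2⟩
  have hε1 : ∀ P : S, P.1 (ε P) ≠ 0 := fun P => by
    rw [map_prod, Finset.prod_ne_zero_iff]
    intro P' hP'
    have := hr P.1 P' (Finset.mem_erase.1 hP').1.symm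
    simpa [sub_eq_zero] using this
  have hn : ∃ n, ∀ P : S, 𝔅.v (ε P) ≤ 𝔅.γ ^ n := by
    choose g hg using fun P : S => 𝔅.exists_v_le (ε P)
    refine ⟨Finset.univ.sup g, fun P => (hg P).trans ?_⟩
    exact pow_le_pow_right₀ 𝔅.one_lt.le (Finset.le_sup (Finset.mem_univ P))
  obtain ⟨n, hn⟩ := hn
  let f : ((S → K) × (𝔅.Idx n → K)) →ₗ[K] R :=
    LinearMap.coprod (Fintype.linearCombination K ε)
      (LinearMap.mulLeft K H ∘ₗ Fintype.linearCombination K (fun e : 𝔅.Idx n => 𝔅.b e.1))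
  have hf : ∀ x y, f (x, y) = ∑ P, x P • ε P + H * ∑ e, y e • 𝔅.b e.1 := fun x y => by
    simp [f, Fintype.linearCombination_apply, Finset.mul_sum]
  have hvf : ∀ x, 𝔅.v (f x) ≤ 𝔅.γ ^ (n + d) := by
    rintro ⟨x, y⟩
    rw [hf]
    refine Valuation.map_add_le _ (Valuation.map_sum_le _ fun P _ => ?_) ?_
    · exact (𝔅.v_smul_le _ _).trans ((hn P).trans
        (pow_le_pow_right₀ 𝔅.one_lt.le (Nat.le_add_right _ _)))
    · rw [map_mul, add_comm, pow_add]
      refine mul_le_mul' hd (Valuation.map_sum_le _ fun e _ => (𝔅.v_smul_le _ _).trans ?_)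
      rw [𝔅.v_b]
      exact pow_le_pow_right₀ 𝔅.one_lt.le e.2
  obtain ⟨⟨x, y⟩, hxy, h0⟩ := 𝔅.exists_ne_zero_map_eq_zero f (n + d) hvf (by
    have := 𝔅.card_idx_add_le n d
    simp only [Module.finrank_prod, Module.finrank_fintype_fun_eq_card, Fintype.card_coe]
    omega)
  rw [hf] at h0
  have hx : x = 0 := by
    funext P
    have h1 := congrArg P.1 h0
    rw [map_add, map_mul, hS P.1 P.2, zero_mul, add_zero, map_sum, map_zero,
      Finset.sum_eq_single P] at h1
    · simpa [hε1 P] using h1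
    · intro P' _ hne
      rw [map_smul, hε0 P' P hne, smul_zero]
    · simp
  apply hxy
  subst hx
  simp only [Pi.zero_apply, zero_smul, Finset.sum_const_zero, zero_add] at h0
  by_contra hne
  have hy : ∃ e ∈ (Finset.univ : Finset (𝔅.Idx n)), y e ≠ 0 := by
    by_contra! hy
    exact hne (by rw [show y = 0 from funext fun e => hy e (Finset.mem_univ e)]; rfl)
  obtain ⟨e, -, -, he, -⟩ := exists_valuation_sum_eq 𝔅.v 𝔅.v_const 𝔅.one_lt
    (u := fun e : 𝔅.Idx n => 𝔅.b e.1) (fun e => 𝔅.v_b e.1)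
    (𝔅.wt_inj.comp Subtype.val_injective) _ y hy
  have h1 := congrArg 𝔅.v h0
  rw [map_mul, he, map_zero, mul_eq_zero] at h1
  exact h1.elim (𝔅.v_ne_zero hH) (𝔅.pow_γ_ne_zero _)

/-- The Stepanov–Bombieri bound for the fixed points of a twisted Frobenius. -/
lemma card_fixed_le_of_lt [IsAlgClosed K] {p : ℕ} [CharP K p] [Fact p.Prime] {α s' l m : ℕ}
    (T : R →ₐ[K] R) (hT : ∀ e, 𝔅.v (T (𝔅.b e)) ≤ 𝔅.γ ^ 𝔅.wt e)
    (S : Finset (R →ₐ[K] K))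
    (hS : ∀ P ∈ S, ∀ e, P (𝔅.b e) ^ (p ^ α * s') = P (T (𝔅.b e)))
    (hl : l < s') (hlm : l * p ^ α + m + 1 < (l + 1 - 𝔅.gap) * (m + 1 - 𝔅.gap)) :
    S.card ≤ l + m * s' := by
  have hs : 0 < p ^ α := pow_pos (Fact.out : p.Prime).pos _
  let f : (𝔅.Idx l × 𝔅.Idx m → K) →ₗ[K] R :=
    Fintype.linearCombination K fun i => 𝔅.b i.1.1 ^ p ^ α * T (𝔅.b i.2.1)
  have hγ := 𝔅.one_lt
  obtain ⟨z, hz, hfz⟩ := 𝔅.exists_ne_zero_map_eq_zero f (l * p ^ α + m) (fun z => by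
      refine Valuation.map_sum_le _ fun i _ => (𝔅.v_smul_le _ _).trans ?_
      rw [map_mul, map_pow, 𝔅.v_b, ← pow_mul, pow_add]
      exact mul_le_mul' (pow_le_pow_right₀ hγ.le (Nat.mul_le_mul_right _ i.1.2))
        ((hT _).trans (pow_le_pow_right₀ hγ.le i.2.2)))
    (by
      have h1 := Nat.mul_le_mul (𝔅.le_card_idx l) (𝔅.le_card_idx m)
      have h2 := 𝔅.card_idx_le (l * p ^ α + m)
      simp only [Module.finrank_fintype_fun_eq_card, Fintype.card_prod]
      omega)
  choose x hx using fun i => IsAlgClosed.exists_pow_nat_eq (z i) hs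
  let H : R := ∑ i, x i • (𝔅.b i.1.1 * 𝔅.b i.2.1 ^ s')
  have hxi : ∃ i ∈ (Finset.univ : Finset (𝔅.Idx l × 𝔅.Idx m)), x i ≠ 0 := by
    by_contra! h
    exact hz (funext fun i => by rw [← hx i, h i (Finset.mem_univ i), zero_pow hs.ne']; rfl)
  obtain ⟨i, -, -, hi, -⟩ := exists_valuation_sum_eq 𝔅.v 𝔅.v_const hγ
    (u := fun i : 𝔅.Idx l × 𝔅.Idx m => 𝔅.b i.1.1 * 𝔅.b i.2.1 ^ s')
    (w := fun i => 𝔅.wt i.1.1 + 𝔅.wt i.2.1 * s')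
    (fun i => by simp only [map_mul, map_pow, 𝔅.v_b, pow_add, pow_mul])
    (by
      rintro ⟨a, c⟩ ⟨a', c'⟩ h
      dsimp only at h
      have ha := a.2
      have ha' := a'.2
      have h1 : 𝔅.wt a.1 = 𝔅.wt a'.1 := by
        have := congrArg (· % s') h
        simpa [Nat.add_mul_mod_self_right, Nat.mod_eq_of_lt (ha.trans_lt hl),
          Nat.mod_eq_of_lt (ha'.trans_lt hl)] using this
      have h2 : 𝔅.wt c.1 = 𝔅.wt c'.1 := by
        rw [h1] at h
        exact Nat.eq_of_mul_eq_mul_right (by omega : 0 < s') (Nat.add_left_cancel h)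
      exact Prod.ext (Subtype.ext (𝔅.wt_inj h1)) (Subtype.ext (𝔅.wt_inj h2)))
    _ x hxi
  have hvH : 𝔅.v H = 𝔅.γ ^ (𝔅.wt i.1.1 + 𝔅.wt i.2.1 * s') := hi
  refine 𝔅.card_zeros_le (H := H) ?_ (d := l + m * s') ?_ S fun P hP => ?_
  · intro h
    rw [h, map_zero] at hvH
    exact 𝔅.pow_γ_ne_zero _ hvH.symm
  · rw [hvH]
    exact pow_le_pow_right₀ hγ.le (add_le_add i.1.2 (Nat.mul_le_mul_right _ i.2.2))
  · have h0 : P H ^ p ^ α = 0 := by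
      have h1 := congrArg P hfz
      rw [map_zero] at h1
      rw [← h1]
      simp only [H, f, Fintype.linearCombination_apply, map_sum, map_smul, map_mul, map_pow,
        smul_eq_mul]
      rw [sum_pow_char_pow]
      refine Finset.sum_congr rfl fun j _ => ?_
      rw [mul_pow, mul_pow, hx, ← pow_mul (P (𝔅.b j.2.1)), mul_comm s', hS P hP]
    exact eq_zero_of_pow_eq_zero h0

lemma card_fixed_le [IsAlgClosed K] {p : ℕ} [CharP K p] [Fact p.Prime] {α s' : ℕ}
    (T : R →ₐ[K] R) (hT : ∀ e, 𝔅.v (T (𝔅.b e)) ≤ 𝔅.γ ^ 𝔅.wt e)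
    (S : Finset (R →ₐ[K] K))
    (hS : ∀ P ∈ S, ∀ e, P (𝔅.b e) ^ (p ^ α * s') = P (T (𝔅.b e)))
    (hs : 2 * 𝔅.gap + 4 ≤ p ^ α) (hs' : p ^ α ≤ s') :
    S.card ≤ p ^ α * s' + (3 * 𝔅.gap + 2) * s' := by
  set s := p ^ α with hsdef
  set B := 𝔅.gap
  have h := 𝔅.card_fixed_le_of_lt (l := B + s / 2 + 1) (m := s + 3 * B + 1) (p := p) (α := α)
    T hT S hS (by omega) (by
      rw [← hsdef, show B + s / 2 + 1 + 1 - B = s / 2 + 2 by omega,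
        show s + 3 * B + 1 + 1 - B = s + 2 * B + 2 by omega]
      have : s ≤ 2 * (s / 2) + 1 := by omega
      nlinarith)
  refine h.trans ?_
  have : B + s / 2 + 1 ≤ s' := by omega
  nlinarith

end WeightedBasis

end WeightedBasis

section LangCurve

open MvPolynomial

/-- In an algebraically closed field the Artin–Schreier tower `y (j + 1) ^ q - y (j + 1) = -a * y j`
has a solution. -/
lemma exists_lang_tower {M : Type*} [Field M] [IsAlgClosed M] {q : ℕ} (hq : 2 ≤ q) (a : M) :
    ∃ y : ℕ → M, y 0 = 1 ∧ ∀ j, y (j + 1) ^ q = y (j + 1) - a * y j := by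
  have key : ∀ c : M, ∃ x : M, x ^ q = x - c := fun c => by
    have hdeg : (Polynomial.X ^ q - (Polynomial.X - Polynomial.C c) : Polynomial M).degree = q := by
      rw [Polynomial.degree_sub_eq_left_of_degree_lt] <;> rw [Polynomial.degree_X_pow]
      rw [Polynomial.degree_X_sub_C]
      exact_mod_cast hq
    obtain ⟨x, hx⟩ := IsAlgClosed.exists_root
      (Polynomial.X ^ q - (Polynomial.X - Polynomial.C c) : Polynomial M)
      (by rw [hdeg]; exact_mod_cast (by omega : q ≠ 0))
    refine ⟨x, ?_⟩
    simpa [Polynomial.IsRoot, sub_eq_zero] using hx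
  choose f hf using key
  exact ⟨fun n => Nat.rec 1 (fun _ x => f (a * x)) n, rfl, fun j => hf _⟩

/-- A field extension with a valuation, trivial on the constants, and an element of valuation
greater than one. -/
lemma exists_isAlgClosed_valuation (K : Type) [Field K] :
    ∃ (L : Type) (_ : Field L) (_ : IsAlgClosed L) (_ : Algebra K L) (Γ : Type)
      (_ : LinearOrderedCommGroupWithZero Γ) (v : Valuation L Γ) (a : L),
      (∀ x : K, x ≠ 0 → v (algebraMap K L x) = 1) ∧ 1 < v a := by
  let L := AlgebraicClosure (FractionRing (Polynomial K))
  let φ : Polynomial K →+* L := (algebraMap (FractionRing (Polynomial K)) L).comp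
    (algebraMap (Polynomial K) (FractionRing (Polynomial K)))
  have hφ : Function.Injective φ :=
    (algebraMap (FractionRing (Polynomial K)) L).injective.comp
      (IsFractionRing.injective (Polynomial K) (FractionRing (Polynomial K)))
  have hI : Ideal.span {φ.rangeRestrict Polynomial.X} ≠ ⊤ := by
    rw [Ne, Ideal.span_singleton_eq_top, isUnit_iff_exists_inv]
    rintro ⟨⟨_, p, rfl⟩, hp⟩
    have h1 : Polynomial.X * p = 1 := hφ (by simpa [Subtype.ext_iff] using hp)
    simpa using congrArg (Polynomial.eval 0) h1
  obtain ⟨V, hV, hV'⟩ := Ideal.image_subset_nonunits_valuationSubring _ hI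
  have hX : V.valuation (φ Polynomial.X) < 1 :=
    hV' ⟨_, Ideal.subset_span rfl, rfl⟩
  have hX0 : φ Polynomial.X ≠ 0 := by
    rw [Ne, map_eq_zero_iff _ hφ]; exact Polynomial.X_ne_zero
  refine ⟨L, inferInstance, inferInstance, inferInstance, _, inferInstance, V.valuation,
    (φ Polynomial.X)⁻¹, fun x hx => ?_, ?_⟩
  · have hle : ∀ y : K, V.valuation (algebraMap K L y) ≤ 1 := fun y => by
      rw [ValuationSubring.valuation_le_one_iff]
      refine hV ⟨Polynomial.C y, ?_⟩
      rw [Polynomial.C_eq_algebraMap, IsScalarTower.algebraMap_apply K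
        (FractionRing (Polynomial K)) L, IsScalarTower.algebraMap_apply K (Polynomial K)
        (FractionRing (Polynomial K))]
      rfl
    refine le_antisymm (hle x) ?_
    have h1 := hle x⁻¹
    rw [map_inv₀, map_inv₀] at h1
    have h2 : V.valuation (algebraMap K L x) ≠ 0 := by simpa using hx
    exact (inv_le_one₀ (zero_lt_iff.2 h2)).1 h1
  · rw [map_inv₀]
    exact (one_lt_inv₀ (zero_lt_iff.2 (by simpa using hX0))).2 hX

variable (K : Type) [Field K] (q k : ℕ)

/-- The generic coefficients `1, y₁, …, y_k` as polynomials. -/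
noncomputable def langVar : ℕ → MvPolynomial (Option (Fin k)) K
  | 0 => 1
  | j + 1 => if h : j < k then X (some ⟨j, h⟩) else 0

/-- The ideal of relations of the Lang torsor `Frob(g) = (1 - a t) g`, `g = 1 + y₁ t + ⋯`. -/
noncomputable def langIdeal : Ideal (MvPolynomial (Option (Fin k)) K) :=
  Ideal.span (Set.range fun j : Fin k =>
    langVar K k (j + 1) ^ q - (langVar K k (j + 1) - X none * langVar K k j))

/-- The coordinate ring of the Lang torsor over the affine line. -/
abbrev LangRing : Type := MvPolynomial (Option (Fin k)) K ⧸ langIdeal K q k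

namespace LangRing

/-- The coordinate on the base. -/
noncomputable def base : LangRing K q k := Ideal.Quotient.mk _ (X none)

/-- The coordinates on the torsor. -/
noncomputable def coord (j : ℕ) : LangRing K q k := Ideal.Quotient.mk _ (langVar K k j)

lemma coord_zero : coord K q k 0 = 1 := rfl

lemma coord_succ_pow {j : ℕ} (hj : j < k) :
    coord K q k (j + 1) ^ q = coord K q k (j + 1) - base K q k * coord K q k j := by
  simp only [coord, base, ← map_pow, ← map_mul, ← map_sub]
  rw [Ideal.Quotient.eq]
  exact Ideal.subset_span ⟨⟨j, hj⟩, rfl⟩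

variable {K q k} in
lemma exists_lift {B : Type*} [CommRing B] [Algebra K B] (a : B) (y : ℕ → B) (hy0 : y 0 = 1)
    (hy : ∀ j < k, y (j + 1) ^ q = y (j + 1) - a * y j) :
    ∃ f : LangRing K q k →ₐ[K] B, f (base K q k) = a ∧ ∀ j ≤ k, f (coord K q k j) = y j := by
  let f₀ : MvPolynomial (Option (Fin k)) K →ₐ[K] B :=
    aeval fun o => o.elim a fun j : Fin k => y (j + 1)
  have hX : f₀ (X none) = a := by simp [f₀]
  have hY : ∀ j ≤ k, f₀ (langVar K k j) = y j := by
    rintro (_ | j) hj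
    · simp [langVar, hy0]
    · simp [langVar, f₀, show j < k from hj]
  refine ⟨Ideal.Quotient.liftₐ _ f₀ fun p hp => ?_, hX, hY⟩
  have : langIdeal K q k ≤ RingHom.ker f₀ := by
    refine Ideal.span_le.2 ?_
    rintro _ ⟨j, rfl⟩
    simp only [SetLike.mem_coe, RingHom.mem_ker, map_sub, map_pow, map_mul]
    rw [hX, hY _ j.2, hY _ j.2.le, hy _ j.2, sub_self]
  exact this hp

/-- Monomials in the coordinates. -/
noncomputable def mono (n : ℕ) (e : Fin k → ℕ) : LangRing K q k :=
  base K q k ^ n * ∏ j : Fin k, coord K q k (j + 1) ^ e j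

lemma mono_add_single (n : ℕ) (e : Fin k → ℕ) (j : Fin k) (c : ℕ) :
    mono K q k n (e + Pi.single j c) = mono K q k n e * coord K q k (j + 1) ^ c := by
  simp only [mono, Pi.add_apply, pow_add, Finset.prod_mul_distrib, mul_assoc]
  congr 2
  rw [Finset.prod_eq_single j]
  · simp
  · intro i _ hi
    simp [Pi.single_eq_of_ne hi]
  · simp

lemma mono_succ (n : ℕ) (e : Fin k → ℕ) :
    mono K q k (n + 1) e = mono K q k n e * base K q k := by
  simp only [mono, pow_succ]; ring

lemma span_mono : (⊤ : Submodule K (LangRing K q k)) ≤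
    Submodule.span K (Set.range fun x : ℕ × (Fin k → ℕ) => mono K q k x.1 x.2) := by
  rintro x -
  obtain ⟨p, rfl⟩ := Ideal.Quotient.mk_surjective x
  rw [p.as_sum, map_sum]
  refine Submodule.sum_mem _ fun d _ => ?_
  have : Ideal.Quotient.mk (langIdeal K q k) (monomial d (p.coeff d)) =
      p.coeff d • mono K q k (d none) (fun j => d (some j)) := by
    rw [monomial_eq, ← MvPolynomial.smul_eq_C_mul, ← Ideal.Quotient.mkₐ_eq_mk K, map_smul,
      Finsupp.prod_fintype _ _ (by simp), Fintype.prod_option, map_mul, map_prod]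
    simp only [mono, base, coord, langVar, Fin.is_lt, dite_true, map_pow, Ideal.Quotient.mkₐ_eq_mk]
  rw [this]
  exact Submodule.smul_mem _ _ (Submodule.subset_span ⟨(d none, fun j => d (some j)), rfl⟩)

variable {q} in
lemma span_reduced (hq : 2 ≤ q) : (⊤ : Submodule K (LangRing K q k)) ≤
    Submodule.span K (Set.range fun x : ℕ × (Fin k → Fin q) =>
      mono K q k x.1 fun j => (x.2 j : ℕ)) := by
  refine (span_mono K q k).trans (Submodule.span_le.2 ?_)
  suffices h : ∀ (N n : ℕ) (e : Fin k → ℕ), ∑ j : Fin k, ((j : ℕ) + 1) * e j = N →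
      mono K q k n e ∈ Submodule.span K (Set.range fun x : ℕ × (Fin k → Fin q) =>
        mono K q k x.1 fun j => (x.2 j : ℕ)) by
    rintro _ ⟨x, rfl⟩
    exact h _ _ _ rfl
  intro N
  induction N using Nat.strong_induction_on with
  | _ N ih =>
    intro n e he
    by_cases hred : ∀ j, e j < q
    · exact Submodule.subset_span ⟨(n, fun j => ⟨e j, hred j⟩), rfl⟩
    push Not at hred
    obtain ⟨j, hj⟩ := hred
    obtain ⟨e', rfl⟩ : ∃ e' : Fin k → ℕ, e = e' + Pi.single j q := by
      refine ⟨e - (Pi.single j q : Fin k → ℕ), ?_⟩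
      funext i
      by_cases h : i = j
      · subst h; simp [Pi.add_apply, Pi.sub_apply, Nat.sub_add_cancel hj]
      · simp [Pi.add_apply, Pi.sub_apply, Pi.single_eq_of_ne h]
    have hsum : ∀ (e : Fin k → ℕ) (j : Fin k) (c : ℕ),
        ∑ i : Fin k, ((i : ℕ) + 1) * (e + Pi.single j c : Fin k → ℕ) i =
          ∑ i : Fin k, ((i : ℕ) + 1) * e i + (j + 1) * c := fun e j c => by
      simp only [Pi.add_apply, mul_add, Finset.sum_add_distrib]
      congr 1
      rw [Finset.sum_eq_single j]
      · simp
      · intro i _ hi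
        simp [Pi.single_eq_of_ne hi]
      · simp
    rw [hsum] at he
    rw [mono_add_single, coord_succ_pow K q k j.2, mul_sub]
    have hlt : ((j : ℕ) + 1) * 1 < (j + 1) * q := by gcongr; omega
    refine Submodule.sub_mem _ ?_ ?_
    · rw [← pow_one (coord K q k _), ← mono_add_single]
      exact ih _ (by omega) _ _ (hsum _ _ _)
    · rw [← mul_assoc, ← mono_succ]
      obtain ⟨_ | i, hi⟩ := j
      · rw [coord_zero, mul_one]
        refine ih _ ?_ _ _ rfl
        simp only at hlt he
        omega
      · have h1 := mono_add_single K q k (n + 1) e' ⟨i, by omega⟩ 1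
        rw [pow_one] at h1
        rw [← h1]
        refine ih _ ?_ _ _ (hsum _ _ _)
        simp only at hlt he ⊢
        omega

end LangRing

/-- The pole order at infinity of the `j`-th coordinate of the Lang torsor. -/
def langWt (q k j : ℕ) : ℕ := q ^ (k - j) * ∑ i ∈ Finset.range j, q ^ i

lemma mul_langWt_succ {q k j : ℕ} (hj : j < k) :
    q * langWt q k (j + 1) = q ^ k + langWt q k j := by
  obtain ⟨d, rfl⟩ := Nat.exists_eq_add_of_lt hj
  simp only [langWt, Finset.sum_range_succ]
  rw [show j + d + 1 - (j + 1) = d by omega, show j + d + 1 - j = d + 1 by omega]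
  ring

lemma langWt_sum_injective {q : ℕ} (k : ℕ) : ∀ e e' : Fin k → ℕ,
    (∀ j, e j < q) → (∀ j, e' j < q) →
    ∑ j : Fin k, e j * langWt q k (j + 1) ≡ ∑ j : Fin k, e' j * langWt q k (j + 1) [MOD q ^ k] →
    e = e' := by
  induction k with
  | zero => exact fun e e' _ _ _ => Subsingleton.elim _ _
  | succ k ih =>
    intro e e' he he' h
    have hq : 0 < q := (Nat.zero_le _).trans_lt (he 0)
    have hsum : ∀ e : Fin (k + 1) → ℕ, ∑ j : Fin (k + 1), e j * langWt q (k + 1) (j + 1) =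
        q * (∑ j : Fin k, e j.castSucc * langWt q k (j + 1)) +
          e (Fin.last k) * (q * ∑ i ∈ Finset.range k, q ^ i + 1) := fun e => by
      rw [Fin.sum_univ_castSucc, Finset.mul_sum]
      congr 1
      · refine Finset.sum_congr rfl fun j _ => ?_
        have : k + 1 - ((j : ℕ) + 1) = k - (j + 1) + 1 := by omega
        simp only [langWt, Fin.val_castSucc, this, pow_succ]
        ring
      · simp only [langWt, Fin.val_last, Nat.sub_self, pow_zero, one_mul]
        rw [Finset.sum_range_succ', Finset.mul_sum]
        simp [pow_succ, mul_comm]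
    rw [hsum, hsum] at h
    have hlast : e (Fin.last k) = e' (Fin.last k) := by
      have h1 := h.of_dvd (dvd_pow_self q (Nat.succ_ne_zero k))
      have h2 : ∀ x y z : ℕ, q * x + y * (q * z + 1) ≡ y [MOD q] := fun x y z => by
        have : q * x + y * (q * z + 1) = y + q * (x + y * z) := by ring
        rw [this]
        simp [Nat.ModEq]
      have h3 := (h2 _ _ _).symm.trans (h1.trans (h2 _ _ _))
      rwa [Nat.ModEq, Nat.mod_eq_of_lt (he _), Nat.mod_eq_of_lt (he' _)] at h3
    rw [hlast] at h
    have h1 := Nat.ModEq.add_right_cancel' _ h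
    rw [pow_succ, mul_comm (q ^ k)] at h1
    have h2 := ih _ _ (fun j => he _) (fun j => he' _) (Nat.ModEq.mul_left_cancel' hq.ne' h1)
    funext j
    induction j using Fin.lastCases with
    | last => exact hlast
    | cast j => exact congrFun h2 j

lemma langWt_sum_surjective {q : ℕ} (hq : 0 < q) (k : ℕ) (n : ℕ) : ∃ e : Fin k → Fin q,
    ∑ j : Fin k, (e j : ℕ) * langWt q k (j + 1) ≡ n [MOD q ^ k] := by
  have hpos : 0 < q ^ k := pow_pos hq k
  let f : (Fin k → Fin q) → Fin (q ^ k) := fun e =>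
    ⟨(∑ j : Fin k, (e j : ℕ) * langWt q k (j + 1)) % q ^ k, Nat.mod_lt _ hpos⟩
  have hf : Function.Bijective f := by
    rw [Fintype.bijective_iff_injective_and_card]
    refine ⟨fun e e' h => ?_, by simp⟩
    have := langWt_sum_injective k (fun j => (e j : ℕ)) (fun j => (e' j : ℕ)) (fun j => (e j).2)
      (fun j => (e' j).2) (by simpa [f, Nat.ModEq] using h)
    funext j
    exact Fin.ext (congrFun this j)
  obtain ⟨e, he⟩ := hf.2 ⟨n % q ^ k, Nat.mod_lt _ hpos⟩
  exact ⟨e, by simpa [f, Nat.ModEq] using he⟩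

/-- The coordinate ring of the Lang torsor has a weighted basis of reduced monomials, with the
valuations of the coordinates prescribed. -/
lemma exists_langRing_weightedBasis {q : ℕ} (hq : 2 ≤ q) :
    ∃ (Γ : Type) (_ : LinearOrderedCommGroupWithZero Γ)
      (𝔅 : WeightedBasis K (LangRing K q k) Γ (ℕ × (Fin k → Fin q))),
      (∀ x, 𝔅.b x = LangRing.mono K q k x.1 fun j => (x.2 j : ℕ)) ∧
      (∀ x, 𝔅.wt x = q ^ k * x.1 + ∑ j : Fin k, (x.2 j : ℕ) * langWt q k (j + 1)) ∧
      𝔅.v (LangRing.base K q k) = 𝔅.γ ^ q ^ k ∧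
      ∀ j ≤ k, 𝔅.v (LangRing.coord K q k j) = 𝔅.γ ^ langWt q k j := by
  obtain ⟨L, _, _, _, Γ, _, v, a, hv, ha⟩ := exists_isAlgClosed_valuation K
  obtain ⟨y, hy0, hy⟩ := exists_lang_tower hq a
  obtain ⟨f, hfa, hfy⟩ := LangRing.exists_lift (K := K) (k := k) a y hy0 fun j _ => hy j
  have hq0 : q ≠ 0 := by omega
  obtain ⟨z, hz⟩ := IsAlgClosed.exists_pow_nat_eq a (pow_pos (by omega : 0 < q) k)
  have hγ : 1 < v z := by
    rw [← hz, map_pow] at ha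
    exact (one_lt_pow_iff (pow_ne_zero k hq0)).1 ha
  have hva : v a = v z ^ q ^ k := by rw [← hz, map_pow]
  have hvy : ∀ j ≤ k, v (y j) = v z ^ langWt q k j := by
    intro j
    induction j with
    | zero => intro _; simp [hy0, langWt]
    | succ j ih =>
      intro hj
      have h1 : v (a * y j) = v z ^ (q * langWt q k (j + 1)) := by
        rw [map_mul, hva, ih (by omega), ← pow_add, mul_langWt_succ hj]
      have hpos : q * langWt q k (j + 1) ≠ 0 := by
        rw [mul_langWt_succ hj]
        have := pow_pos (by omega : 0 < q) k
        omega
      have h2 : a * y j = y (j + 1) - y (j + 1) ^ q := by rw [hy j]; ring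
      have h3 : 1 < v (y (j + 1)) := by
        by_contra! hle
        have h4 : v (a * y j) ≤ 1 := by
          rw [h2]
          refine (v.map_sub _ _).trans (max_le hle ?_)
          rw [map_pow]
          exact pow_le_one' hle q
        rw [h1] at h4
        exact absurd h4 (not_le.2 (one_lt_pow' hγ hpos))
      have h5 : v (y (j + 1) - y (j + 1) ^ q) = v (y (j + 1)) ^ q := by
        rw [Valuation.map_sub_swap, Valuation.map_sub_eq_of_lt_left, map_pow]
        rw [map_pow]
        conv_lhs => rw [← pow_one (v (y (j + 1)))]
        exact pow_lt_pow_right₀ h3 (by omega)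
      rw [← h2, h1, mul_comm, pow_mul] at h5
      exact ((pow_left_inj₀ zero_le zero_le hq0).1 h5).symm
  refine ⟨Γ, inferInstance,
    { v := v.comap f.toRingHom
      v_const := fun x hx => ?_
      γ := v z
      one_lt := hγ
      b := fun x => LangRing.mono K q k x.1 fun j => (x.2 j : ℕ)
      wt := fun x => q ^ k * x.1 + ∑ j : Fin k, (x.2 j : ℕ) * langWt q k (j + 1)
      v_b := fun x => ?_
      wt_inj := fun x x' h => ?_
      span := LangRing.span_reduced K k hq
      gap := ∑ j : Fin k, q * langWt q k (j + 1)
      exists_wt := fun n hn => ?_ }, fun _ => rfl, fun _ => rfl, ?_, fun j hj => ?_⟩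
  · simpa using hv x hx
  · simp only [Valuation.comap_apply, AlgHom.toRingHom_eq_coe, RingHom.coe_coe, LangRing.mono,
      map_mul, map_pow, map_prod, hfa, hva]
    rw [pow_add, pow_mul, ← Finset.prod_pow_eq_pow_sum]
    congr 1
    refine Finset.prod_congr rfl fun j _ => ?_
    rw [hfy _ j.2, hvy _ j.2, ← pow_mul, mul_comm]
  · dsimp only at h
    have h2 : x.2 = x'.2 := by
      have := langWt_sum_injective k (fun j => (x.2 j : ℕ)) (fun j => (x'.2 j : ℕ))
        (fun j => (x.2 j).2) (fun j => (x'.2 j).2) (by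
          have := congrArg (· % q ^ k) h
          simpa [Nat.ModEq] using this)
      funext j
      exact Fin.ext (congrFun this j)
    rw [h2] at h
    exact Prod.ext (Nat.eq_of_mul_eq_mul_left (pow_pos (by omega) k) (Nat.add_right_cancel h)) h2
  · obtain ⟨e, he⟩ := langWt_sum_surjective (by omega : 0 < q) k n
    have hle : ∑ j : Fin k, (e j : ℕ) * langWt q k (j + 1) ≤ n :=
      (Finset.sum_le_sum fun j _ => Nat.mul_le_mul_right _ (e j).2.le).trans hn
    obtain ⟨c, hc⟩ := (Nat.modEq_iff_dvd' hle).1 he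
    exact ⟨(c, e), by dsimp only; omega⟩
  · simp [hfa, hva]
  · simp [hfy j hj, hvy j hj]

end LangCurve

section LangPoints

/-- Convolving a solution of the Lang tower with a Frobenius-invariant sequence. -/
lemma lang_tower_conv {B : Type*} [CommRing B] {q k : ℕ} (φ : B →+* B)
    (hφ : ∀ x, φ x = x ^ q) {a : B} {c y : ℕ → B} (hc : ∀ j, c j ^ q = c j) (hy0 : y 0 = 1)
    (hy : ∀ j < k, y (j + 1) ^ q = y (j + 1) - a * y j) {j : ℕ} (hj : j < k) :
    (∑ x ∈ Finset.HasAntidiagonal.antidiagonal (j + 1), c x.1 * y x.2) ^ q =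
      ∑ x ∈ Finset.HasAntidiagonal.antidiagonal (j + 1), c x.1 * y x.2 -
        a * ∑ x ∈ Finset.HasAntidiagonal.antidiagonal j, c x.1 * y x.2 := by
  rw [Finset.Nat.sum_antidiagonal_succ', ← hφ, map_add, map_sum]
  simp only [map_mul]
  simp only [hφ, hc, hy0, one_pow, mul_one]
  rw [Finset.mul_sum, add_sub_assoc, ← Finset.sum_sub_distrib]
  congr 1
  refine Finset.sum_congr rfl fun x hx => ?_
  rw [hy _ (by have := Finset.HasAntidiagonal.mem_antidiagonal.1 hx; omega)]
  ring

open PowerSeries in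
/-- Iterating Frobenius on a solution of the Lang tower. -/
lemma lang_tower_iterate {K : Type*} [Field K] {q : ℕ} (φ : K →+* K)
    (hφ : ∀ x, φ x = x ^ q) {a : K} {y : ℕ → K} (hy0 : y 0 = 1)
    (hy : ∀ j, y (j + 1) ^ q = y (j + 1) - a * y j) (r j : ℕ) :
    y j ^ q ^ r = ∑ x ∈ Finset.HasAntidiagonal.antidiagonal j,
      coeff x.1 (∏ i ∈ Finset.range r, (1 - C (a ^ q ^ i) * X : K⟦X⟧)) * y x.2 := by
  have h1 : ∀ r, map (φ ^ r) (mk y) =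
      (∏ i ∈ Finset.range r, (1 - C (a ^ q ^ i) * X : K⟦X⟧)) * mk y := by
    intro r
    induction r with
    | zero => ext; simp
    | succ r ih =>
      have h2 : map φ (mk y) = (1 - C a * X) * mk y := by
        ext j
        rw [sub_mul, one_mul, mul_assoc, map_sub, coeff_C_mul]
        cases j with
        | zero => simp [hy0, hφ]
        | succ j => simp [coeff_succ_X_mul, hφ, hy]
      have h3 : map (φ ^ (r + 1)) (mk y) = map φ (map (φ ^ r) (mk y)) := by
        ext j
        simp [pow_succ']
      rw [h3, ih, map_mul, h2, ← mul_assoc, map_prod, Finset.prod_range_succ']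
      congr 2
      · refine Finset.prod_congr rfl fun i _ => ?_
        simp [hφ, ← pow_mul, pow_succ, mul_comm]
      · simp
  have h2 : ∀ r x, (φ ^ r) x = x ^ q ^ r := by
    intro r x
    induction r with
    | zero => simp
    | succ r ih => rw [pow_succ', RingHom.mul_def, RingHom.comp_apply, ih, hφ, ← pow_mul, pow_succ]
  have h3 := congrArg (coeff j) (h1 r)
  rw [coeff_map, coeff_mk, h2, coeff_mul] at h3
  simpa only [coeff_mk] using h3

lemma langWt_mono {q k : ℕ} {i j : ℕ} (hij : i ≤ j) (hj : j ≤ k) :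
    langWt q k i ≤ langWt q k j := by
  induction j, hij using Nat.le_induction with
  | base => exact le_rfl
  | succ j hij ih =>
    refine (ih (by omega)).trans ?_
    rw [langWt, langWt, Finset.sum_range_succ', show k - j = k - (j + 1) + 1 by omega, pow_succ,
      mul_assoc, Finset.mul_sum]
    refine Nat.mul_le_mul_left _ ?_
    simp only [pow_succ', pow_zero]
    omega

variable (F : Type) [Field F] [Fintype F] (K : Type) [Field K] [Algebra F K] [IsAlgClosed K]

set_option maxHeartbeats 1000000 in
open PowerSeries in
/-- The number of `a` fixed by the `r`-th power of Frobenius with prescribed leading coefficients of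
`∏ (1 - a ^ (q ^ i) t)` is at most its expected value up to a square-root error. -/
lemma exists_card_frobenius_prod_le (k : ℕ) : ∃ D r₀ : ℕ, ∀ r ≥ r₀, ∀ c : ℕ → K,
    c 0 = 1 → (∀ j, c j ^ Fintype.card F = c j) → ∀ S : Finset K,
    (∀ a ∈ S, a ^ Fintype.card F ^ r = a ∧ ∀ j ≤ k,
      coeff j (∏ i ∈ Finset.range r, (1 - C (a ^ Fintype.card F ^ i) * X : K⟦X⟧)) = c j) →
    Fintype.card F ^ k * S.card ≤
      Fintype.card F ^ r + D * Fintype.card F ^ ((r + 1) / 2) := by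
  obtain ⟨p, hpF⟩ := CharP.exists F
  obtain ⟨f, hp, hf⟩ := FiniteField.card F p
  have : Fact p.Prime := ⟨hp⟩
  have : CharP K p := charP_of_injective_algebraMap (algebraMap F K).injective p
  have hq2 : 2 ≤ Fintype.card F := Fintype.one_lt_card
  have hFK : ∀ x : F, algebraMap F K x ^ Fintype.card F = algebraMap F K x := fun x => by
    rw [← map_pow, FiniteField.pow_card]
  generalize hq : Fintype.card F = q at *
  obtain ⟨Γ, _, 𝔅, hb, hwt, hva, hvy⟩ := exists_langRing_weightedBasis K k hq2
  have : Nontrivial (LangRing K q k) := by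
    by_contra h
    rw [not_nontrivial_iff_subsingleton] at h
    have := congrArg 𝔅.v (Subsingleton.elim (0 : LangRing K q k) 1)
    simp at this
  have : CharP (LangRing K q k) p :=
    charP_of_injective_algebraMap (algebraMap K (LangRing K q k)).injective p
  have hq0 : q ≠ 0 := by omega
  have hφK : ∀ x : K, iterateFrobenius K p f x = x ^ q := fun x => by
    rw [iterateFrobenius_def, hf]
  have hφR : ∀ x : LangRing K q k, iterateFrobenius (LangRing K q k) p f x = x ^ q := fun x => by
    rw [iterateFrobenius_def, ← hf]
  refine ⟨3 * 𝔅.gap + 2, 2 * (2 * 𝔅.gap + 4), fun r hr c hc0 hc S hS => ?_⟩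
  -- the translation of the torsor by `c`
  have hconv : ∀ j < k, (∑ x ∈ Finset.HasAntidiagonal.antidiagonal (j + 1),
      algebraMap K (LangRing K q k) (c x.1) * LangRing.coord K q k x.2) ^ q =
      ∑ x ∈ Finset.HasAntidiagonal.antidiagonal (j + 1),
        algebraMap K (LangRing K q k) (c x.1) * LangRing.coord K q k x.2 - LangRing.base K q k *
      ∑ x ∈ Finset.HasAntidiagonal.antidiagonal j,
        algebraMap K (LangRing K q k) (c x.1) * LangRing.coord K q k x.2 := fun j hj =>
    lang_tower_conv (c := fun j => algebraMap K (LangRing K q k) (c j))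
      (iterateFrobenius (LangRing K q k) p f) hφR
      (fun j => by rw [← map_pow (algebraMap K (LangRing K q k)), hc]) (LangRing.coord_zero K q k)
      (fun j hj => LangRing.coord_succ_pow K q k hj) hj
  obtain ⟨T, hTa, hTy⟩ := LangRing.exists_lift (K := K) (q := q) (k := k) (LangRing.base K q k)
    (fun j => ∑ x ∈ Finset.HasAntidiagonal.antidiagonal j,
      algebraMap K (LangRing K q k) (c x.1) * LangRing.coord K q k x.2)
    (by simp [hc0, LangRing.coord_zero]) hconv
  have hconst : ∀ x : K, 𝔅.v (algebraMap K _ x) ≤ 1 := fun x => by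
    by_cases hx : x = 0
    · simp [hx]
    · exact (𝔅.v_const x hx).le
  have hvT : ∀ j ≤ k, 𝔅.v (T (LangRing.coord K q k j)) ≤ 𝔅.γ ^ langWt q k j := by
    intro j hj
    rw [hTy j hj]
    refine 𝔅.v.map_sum_le fun x hx => ?_
    have hx := Finset.HasAntidiagonal.mem_antidiagonal.1 hx
    rw [map_mul, hvy _ (by omega)]
    exact (mul_le_of_le_one_left' (hconst _)).trans
      (pow_le_pow_right₀ 𝔅.one_lt.le (langWt_mono (by omega) hj))
  have hT : ∀ e, 𝔅.v (T (𝔅.b e)) ≤ 𝔅.γ ^ 𝔅.wt e := by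
    intro e
    rw [hb, hwt, LangRing.mono]
    simp only [map_mul, map_pow, map_prod]
    rw [hTa, hva, pow_add, pow_mul, ← Finset.prod_pow_eq_pow_sum]
    refine mul_le_mul_right (Finset.prod_le_prod (fun _ _ => zero_le) fun j _ => ?_) _
    rw [mul_comm, pow_mul]
    exact pow_le_pow_left₀ zero_le (hvT _ j.2) _
  -- the points
  choose η hη0 hη using fun a : K => exists_lang_tower hq2 a
  let e : (Fin k → F) → ℕ → K := fun u j =>
    j.casesOn 1 fun j => if h : j < k then algebraMap F K (u ⟨j, h⟩) else 0
  have he0 : ∀ u, e u 0 = 1 := fun u => rfl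
  have heq : ∀ u j, e u j ^ q = e u j := by
    rintro u (_ | j)
    · simp [e]
    · by_cases h : j < k
      · simp only [e, h, dite_true, hFK]
      · simp [e, h, hq0]
  let Y : K × (Fin k → F) → ℕ → K := fun z j =>
    ∑ x ∈ Finset.HasAntidiagonal.antidiagonal j, e z.2 x.1 * η z.1 x.2
  have hY0 : ∀ z, Y z 0 = 1 := fun z => by simp [Y, he0, hη0]
  have hY : ∀ z j, Y z (j + 1) ^ q = Y z (j + 1) - z.1 * Y z j := fun z j =>
    lang_tower_conv _ hφK (heq z.2) (hη0 z.1) (fun j _ => hη z.1 j) (Nat.lt_succ_self j)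
  choose P hPa hPy using fun z => LangRing.exists_lift (K := K) (q := q) (k := k) z.1 (Y z) (hY0 z)
    (fun j _ => hY z j)
  have hinj : Function.Injective P := by
    intro z w h
    have h1 : z.1 = w.1 := by rw [← hPa z, ← hPa w, h]
    refine Prod.ext h1 ?_
    have h2 : (X : K⟦X⟧) ^ (k + 1) ∣ (mk (e z.2) - mk (e w.2)) * mk (η z.1) := by
      rw [X_pow_dvd_iff]
      intro j hj
      rw [sub_mul, map_sub, coeff_mul, coeff_mul, sub_eq_zero]
      simp only [coeff_mk]
      have h3 := hPy w j (by omega)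
      rw [← h, hPy z j (by omega)] at h3
      simp only [Y, ← h1] at h3
      exact h3
    have hu : IsUnit (mk (η z.1)) := by
      rw [isUnit_iff_constantCoeff, ← coeff_zero_eq_constantCoeff_apply, coeff_mk, hη0]
      exact isUnit_one
    rw [hu.dvd_mul_right, X_pow_dvd_iff] at h2
    funext j
    have h3 := h2 (j + 1) (by omega)
    rw [map_sub, coeff_mk, coeff_mk, sub_eq_zero] at h3
    simpa [e] using h3
  have hfix : ∀ z : K × (Fin k → F), z.1 ∈ S → ∀ x, P z (𝔅.b x) ^ q ^ r = P z (T (𝔅.b x)) := by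
    intro z hz x
    obtain ⟨ha, hz⟩ := hS _ hz
    rw [hb, LangRing.mono]
    simp only [map_mul, map_pow, map_prod, mul_pow, ← Finset.prod_pow]
    rw [hTa, hPa, pow_right_comm, ha]
    congr 1
    refine Finset.prod_congr rfl fun j _ => ?_
    rw [pow_right_comm, hTy _ j.2, hPy _ _ j.2, lang_tower_iterate _ hφK (hY0 z) (hY z), map_sum]
    congr 1
    refine Finset.sum_congr rfl fun x hx => ?_
    have hx := Finset.HasAntidiagonal.mem_antidiagonal.1 hx
    have := j.2
    rw [hz _ (by omega), map_mul, hPy _ _ (by omega), AlgHom.commutes]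
    rfl
  have hr2 : r / 2 + (r + 1) / 2 = r := by omega
  have hs : p ^ ((f : ℕ) * (r / 2)) = q ^ (r / 2) := by rw [hf, pow_mul]
  have hmain := 𝔅.card_fixed_le T hT (p := p) (α := f * (r / 2)) (s' := q ^ ((r + 1) / 2))
    ((S ×ˢ (Finset.univ : Finset (Fin k → F))).image P) (by
      rintro _ hP x
      obtain ⟨z, hz, rfl⟩ := Finset.mem_image.1 hP
      rw [hs, ← pow_add, hr2]
      exact hfix z (Finset.mem_product.1 hz).1 x)
    (by
      rw [hs]
      calc 2 * 𝔅.gap + 4 ≤ r / 2 := by omega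
        _ ≤ q ^ (r / 2) := (Nat.lt_pow_self hq2).le)
    (by rw [hs]; exact Nat.pow_le_pow_right (by omega) (by omega))
  rw [Finset.card_image_of_injective _ hinj, hs, ← pow_add, hr2, Finset.card_product,
    Finset.card_univ, Fintype.card_fun, Fintype.card_fin, hq, mul_comm] at hmain
  exact hmain

end LangPoints

section FrobeniusOrbit

open Polynomial

variable (F : Type) [Field F] [Fintype F] {K : Type} [Field K] [Algebra F K]

/-- The size of the Frobenius orbit of `a`, or zero if it is infinite. -/
noncomputable def frobDegree (a : K) : ℕ :=
  Function.minimalPeriod (FiniteField.frobeniusAlgHom F K) a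

lemma frobeniusAlgHom_iterate (r : ℕ) (a : K) :
    (FiniteField.frobeniusAlgHom F K)^[r] a = a ^ Fintype.card F ^ r := by
  induction r with
  | zero => simp
  | succ r ih =>
    rw [Function.iterate_succ_apply', ih, FiniteField.coe_frobeniusAlgHom, pow_succ, pow_mul]

lemma frobDegree_dvd_iff {a : K} {r : ℕ} : frobDegree F a ∣ r ↔ a ^ Fintype.card F ^ r = a := by
  rw [frobDegree, ← Function.isPeriodicPt_iff_minimalPeriod_dvd, Function.IsPeriodicPt,
    Function.IsFixedPt, frobeniusAlgHom_iterate]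

lemma pow_frobDegree_mul_add (a : K) (m i : ℕ) :
    a ^ Fintype.card F ^ (frobDegree F a * m + i) = a ^ Fintype.card F ^ i := by
  rw [pow_add, pow_mul, (frobDegree_dvd_iff F).1 (dvd_mul_right _ m)]

lemma exists_algebraMap_eq_of_pow_card_eq {a : K} (ha : a ^ Fintype.card F = a) :
    ∃ x : F, algebraMap F K x = a := by
  have h1 : 1 < Fintype.card F := Fintype.one_lt_card
  have hne := FiniteField.X_pow_card_sub_X_ne_zero K h1
  have hsub : Finset.univ.image (algebraMap F K) ⊆
      (X ^ Fintype.card F - X : K[X]).roots.toFinset := by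
    intro y hy
    obtain ⟨x, -, rfl⟩ := Finset.mem_image.1 hy
    rw [Multiset.mem_toFinset, mem_roots hne]
    simp [← map_pow, FiniteField.pow_card]
  have hcard : (X ^ Fintype.card F - X : K[X]).roots.toFinset.card ≤
      (Finset.univ.image (algebraMap F K)).card := by
    rw [Finset.card_image_of_injective _ (algebraMap F K).injective, Finset.card_univ]
    refine (Multiset.toFinset_card_le _).trans ((card_roots' _).trans ?_)
    rw [FiniteField.X_pow_card_sub_X_natDegree_eq K h1]
  have ha' : a ∈ (X ^ Fintype.card F - X : K[X]).roots.toFinset := by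
    rw [Multiset.mem_toFinset, mem_roots hne]
    simp [ha]
  rw [← Finset.eq_of_subset_of_card_le hsub hcard] at ha'
  obtain ⟨x, -, hx⟩ := Finset.mem_image.1 ha'
  exact ⟨x, hx⟩

lemma map_minpoly_eq_prod {a : K} (ha : 0 < frobDegree F a) :
    (minpoly F a).map (algebraMap F K) =
      ∏ i ∈ Finset.range (frobDegree F a), (X - C (a ^ Fintype.card F ^ i)) := by
  set d := frobDegree F a with hd
  set f : K[X] := ∏ i ∈ Finset.range d, (X - C (a ^ Fintype.card F ^ i)) with hf
  have hmonic : f.Monic := monic_prod_of_monic _ _ fun i _ => monic_X_sub_C _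
  have hd1 : a ^ Fintype.card F ^ d = a := (frobDegree_dvd_iff F).1 dvd_rfl
  have hmap : f.map (FiniteField.frobeniusAlgHom F K : K →+* K) = f := by
    have h1 : f.map (FiniteField.frobeniusAlgHom F K : K →+* K) =
        ∏ i ∈ Finset.range d, (X - C (a ^ Fintype.card F ^ (i + 1))) := by
      simp [hf, Polynomial.map_prod, ← pow_mul, pow_succ, mul_comm]
    rw [h1]
    obtain ⟨e, he⟩ : ∃ e, d = e + 1 := ⟨d - 1, by omega⟩
    rw [hf, he, Finset.prod_range_succ, ← he, hd1, he, Finset.prod_range_succ']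
    simp
  obtain ⟨g, hg⟩ : ∃ g : F[X], g.map (algebraMap F K) = f := by
    have : f ∈ lifts (algebraMap F K) := by
      rw [lifts_iff_coeff_lifts]
      intro n
      have h1 := congrArg (fun p => coeff p n) hmap
      simp only [coeff_map] at h1
      exact exists_algebraMap_eq_of_pow_card_eq F h1
    exact (mem_lifts _).1 this
  have hroot : ∀ i, (aeval (a ^ Fintype.card F ^ i)) (minpoly F a) = 0 := by
    intro i
    induction i with
    | zero => simp
    | succ i ih =>
      have := congrArg (FiniteField.frobeniusAlgHom F K) ih
      rw [← aeval_algHom_apply, map_zero, FiniteField.coe_frobeniusAlgHom] at this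
      rwa [pow_succ, pow_mul]
  have h1 : f ∣ (minpoly F a).map (algebraMap F K) := by
    refine Finset.prod_dvd_of_coprime ?_ fun i _ => ?_
    · intro i hi j hj hij
      refine (pairwise_coprime_X_sub_C (s := id) Function.injective_id) fun h => hij ?_
      have := Function.iterate_injOn_Iio_minimalPeriod (f := FiniteField.frobeniusAlgHom F K)
        (x := a)
      refine this (Finset.mem_range.1 hi) (Finset.mem_range.1 hj) ?_
      simpa only [frobeniusAlgHom_iterate] using h
    · rw [dvd_iff_isRoot, IsRoot, eval_map_algebraMap, hroot]
  have hgm : g.Monic := monic_of_injective (algebraMap F K).injective (by rwa [hg])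
  have hroot0 : aeval a g = 0 := by
    rw [← eval_map_algebraMap, hg, hf, eval_prod]
    exact Finset.prod_eq_zero (Finset.mem_range.2 ha) (by simp)
  have hint : IsIntegral F a := ⟨g, hgm, hroot0⟩
  have h2 : (minpoly F a).map (algebraMap F K) ∣ f := by
    rw [← hg]
    exact Polynomial.map_dvd _ (minpoly.dvd _ _ hroot0)
  exact eq_of_monic_of_associated ((minpoly.monic hint).map _) hmonic (associated_of_dvd_dvd h2 h1)

lemma isIntegral_of_frobDegree_pos {a : K} (ha : 0 < frobDegree F a) : IsIntegral F a := by
  by_contra h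
  have h1 := map_minpoly_eq_prod F ha
  rw [minpoly.eq_zero h, Polynomial.map_zero] at h1
  exact (monic_prod_of_monic (Finset.range (frobDegree F a)) _ fun i _ =>
    monic_X_sub_C (a ^ Fintype.card F ^ i)).ne_zero h1.symm

lemma natDegree_minpoly_eq_frobDegree {a : K} (ha : 0 < frobDegree F a) :
    (minpoly F a).natDegree = frobDegree F a := by
  rw [← natDegree_map (algebraMap F K), map_minpoly_eq_prod F ha, natDegree_prod_of_monic]
  · simp only [natDegree_X_sub_C, Finset.sum_const, Finset.card_range, smul_eq_mul, mul_one]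
  · exact fun i _ => monic_X_sub_C _

lemma map_minpoly_pow_eq_prod {a : K} (ha : 0 < frobDegree F a) (m : ℕ) :
    (minpoly F a ^ m).map (algebraMap F K) =
      ∏ i ∈ Finset.range (frobDegree F a * m), (X - C (a ^ Fintype.card F ^ i)) := by
  induction m with
  | zero => simp
  | succ m ih =>
    rw [pow_succ, Polynomial.map_mul, ih, mul_add, mul_one, Finset.prod_range_add,
      map_minpoly_eq_prod F ha]
    simp only [pow_frobDegree_mul_add]

lemma frobDegree_pos [Algebra.IsAlgebraic F K] (a : K) : 0 < frobDegree F a := by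
  have hint : IsIntegral F a := Algebra.IsIntegral.isIntegral a
  have := IntermediateField.adjoin.finiteDimensional hint
  have : Finite (IntermediateField.adjoin F {a}) := Module.finite_of_finite F
  have hinj : Function.Injective
      (FiniteField.frobeniusAlgHom F (IntermediateField.adjoin F {a})) := RingHom.injective _
  obtain ⟨n, hn, h⟩ := hinj.mem_periodicPts (IntermediateField.AdjoinSimple.gen F a)
  rw [Function.IsPeriodicPt, Function.IsFixedPt, frobeniusAlgHom_iterate] at h
  have h1 := congrArg (algebraMap (IntermediateField.adjoin F {a}) K) h
  rw [map_pow, IntermediateField.AdjoinSimple.algebraMap_gen, ← frobDegree_dvd_iff] at h1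
  exact Nat.pos_of_dvd_of_pos h1 hn

/-- The multiplicity of `a` as a root of `f` counts the powers of its minimal polynomial
dividing `f`. -/
lemma card_minpoly_pow_dvd [Algebra.IsAlgebraic F K] (a : K) {f : F[X]} (hf : f ≠ 0) {n : ℕ}
    (hn : f.natDegree ≤ n) :
    ((Finset.Icc 1 n).filter fun m => minpoly F a ^ m ∣ f).card =
      (f.map (algebraMap F K)).rootMultiplicity a := by
  have hint : IsIntegral F a := Algebra.IsIntegral.isIntegral a
  have hirr := minpoly.irreducible hint
  obtain ⟨v, u, hu, rfl⟩ := WfDvdMonoid.max_power_factor hf hirr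
  have hu0 : u ≠ 0 := right_ne_zero_of_mul hf
  have hmap0 : ((minpoly F a ^ v * u).map (algebraMap F K)) ≠ 0 := by
    rwa [Ne, Polynomial.map_eq_zero]
  have h1 : ∀ m, minpoly F a ^ m ∣ minpoly F a ^ v * u ↔ m ≤ v := by
    intro m
    refine ⟨fun h => ?_, fun h => (pow_dvd_pow _ h).mul_right _⟩
    by_contra! hlt
    refine hu ?_
    have := (pow_dvd_pow _ hlt).trans h
    rw [pow_succ] at this
    exact (mul_dvd_mul_iff_left (pow_ne_zero _ hirr.ne_zero)).1 this
  have hvn : v ≤ n := by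
    refine le_trans ?_ hn
    rw [natDegree_mul (pow_ne_zero _ hirr.ne_zero) hu0, natDegree_pow]
    nlinarith [minpoly.natDegree_pos hint]
  have hset : ((Finset.Icc 1 n).filter fun m => minpoly F a ^ m ∣ minpoly F a ^ v * u) =
      Finset.Icc 1 v := by
    ext m
    simp only [Finset.mem_filter, Finset.mem_Icc, h1]
    omega
  have hmin : ((minpoly F a).map (algebraMap F K)).rootMultiplicity a = 1 := by
    refine le_antisymm (rootMultiplicity_le_one_of_separable
      (PerfectField.separable_of_irreducible hirr).map a) ?_
    rw [Nat.one_le_iff_ne_zero, ← Nat.pos_iff_ne_zero, rootMultiplicity_pos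
      (by rw [Ne, Polynomial.map_eq_zero]; exact hirr.ne_zero)]
    simp [IsRoot]
  have hu1 : (u.map (algebraMap F K)).rootMultiplicity a = 0 := by
    refine rootMultiplicity_eq_zero fun h => hu (minpoly.dvd _ _ ?_)
    simpa [IsRoot] using h
  rw [hset, Nat.card_Icc, Polynomial.map_mul, Polynomial.map_pow, rootMultiplicity_mul (by
    rwa [← Polynomial.map_pow, ← Polynomial.map_mul]), hu1]
  have : ∀ v : ℕ, (((minpoly F a).map (algebraMap F K)) ^ v).rootMultiplicity a = v := by
    intro v
    rw [← count_roots, roots_pow, Multiset.count_nsmul, count_roots, hmin, mul_one]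
  rw [this]
  omega

end FrobeniusOrbit

section LeadingClass

open PowerSeries

/-- A homomorphism from the power series with constant coefficient one onto `G` that records exactly
the coefficients up to degree `k`. -/
structure LeadingClass (F : Type) [Field F] (k : ℕ) (G : Type) [AddCommGroup G] where
  /-- The class of a power series. -/
  cls : F⟦X⟧ → G
  cls_mul : ∀ p p', constantCoeff p = 1 → constantCoeff p' = 1 → cls (p * p') = cls p + cls p'
  cls_eq_iff : ∀ p p', constantCoeff p = 1 → constantCoeff p' = 1 →
    (cls p = cls p' ↔ ∀ j ≤ k, coeff j p = coeff j p')
  exists_cls_eq : ∀ g, ∃ p, constantCoeff p = 1 ∧ cls p = g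

lemma exists_leadingClass (F : Type) [Field F] (k : ℕ) :
    ∃ (G : Type) (_ : AddCommGroup G), Nonempty (LeadingClass F k G) := by
  let π := Ideal.Quotient.mk (Ideal.span {(X : F⟦X⟧) ^ (k + 1)})
  let H : Subgroup (F⟦X⟧ ⧸ Ideal.span {(X : F⟦X⟧) ^ (k + 1)})ˣ :=
    (Units.map (constantCoeff (R := F)).toMonoidHom).ker.map (Units.map π.toMonoidHom)
  have hunit : ∀ p : F⟦X⟧, constantCoeff p = 1 → IsUnit p := fun p hp => by
    rw [isUnit_iff_constantCoeff, hp]; exact isUnit_one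
  have hmem : ∀ (p : F⟦X⟧) (hp : constantCoeff p = 1),
      Units.map π.toMonoidHom (hunit p hp).unit ∈ H := fun p hp =>
    ⟨_, Units.ext (by simpa using hp), rfl⟩
  let ρ : F⟦X⟧ → Additive H := fun p =>
    if hp : constantCoeff p = 1 then Additive.ofMul ⟨_, hmem p hp⟩ else 0
  have hρ : ∀ p p', ∀ hp : constantCoeff p = 1, ∀ hp' : constantCoeff p' = 1,
      ρ p = ρ p' ↔ π p = π p' := fun p p' hp hp' => by
    simp only [ρ, hp, hp', dite_true]
    rw [Additive.ofMul.injective.eq_iff, Subtype.mk.injEq, Units.ext_iff]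
    rfl
  refine ⟨Additive H, inferInstance, ⟨⟨ρ, fun p p' hp hp' => ?_, fun p p' hp hp' => ?_, ?_⟩⟩⟩
  · have hpp : constantCoeff (p * p') = 1 := by rw [map_mul, hp, hp', one_mul]
    simp only [ρ, hp, hp', hpp, dite_true]
    rw [← ofMul_mul]
    congr 1
    refine Subtype.ext (Units.ext ?_)
    exact map_mul π p p'
  · rw [hρ p p' hp hp', Ideal.Quotient.eq, Ideal.mem_span_singleton, X_pow_dvd_iff]
    simp only [map_sub, sub_eq_zero, Nat.lt_succ_iff]
  · rintro ⟨_, u, hu, rfl⟩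
    have hu1 : constantCoeff (u : F⟦X⟧) = 1 := by
      simpa using congrArg Units.val (MonoidHom.mem_ker.1 hu)
    refine ⟨u, hu1, ?_⟩
    simp only [ρ, hu1, dite_true]
    exact congrArg Additive.ofMul (Subtype.ext (Units.ext rfl))

namespace LeadingClass

variable {F : Type} [Field F] {k : ℕ} {G : Type} [AddCommGroup G] (ρ : LeadingClass F k G)
include ρ

lemma cls_one : ρ.cls 1 = 0 := by
  have := ρ.cls_mul 1 1 (by simp) (by simp)
  simpa using this

lemma natCard_eq [Fintype F] : Nat.card G = Fintype.card F ^ k := by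
  let s : (Fin k → F) → F⟦X⟧ := fun u => PowerSeries.mk fun j : ℕ =>
    j.casesOn 1 fun j => if h : j < k then u ⟨j, h⟩ else 0
  have hs : ∀ u, constantCoeff (s u) = 1 := fun u => by
    rw [← coeff_zero_eq_constantCoeff_apply, coeff_mk]; rfl
  have : Function.Bijective fun u => ρ.cls (s u) := by
    refine ⟨fun u u' h => ?_, fun g => ?_⟩
    · have h1 := (ρ.cls_eq_iff _ _ (hs u) (hs u')).1 h
      funext j
      simpa [s] using h1 (j + 1) (by omega)
    · obtain ⟨p, hp, rfl⟩ := ρ.exists_cls_eq g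
      let u : Fin k → F := fun j => coeff (j + 1) p
      refine ⟨u, (ρ.cls_eq_iff (s u) p (hs u) hp).2 ?_⟩
      rintro (_ | j) hj
      · simpa using (hs _).trans hp.symm
      · simp [s, u, Nat.lt_of_succ_le hj]
  rw [← Nat.card_congr (Equiv.ofBijective _ this), Nat.card_eq_fintype_card, Fintype.card_fun,
    Fintype.card_fin]

end LeadingClass

end LeadingClass

section Monics

open Polynomial

variable {F : Type} [Field F]

lemma coeff_monicOfCoeffs_add {n : ℕ} (c : Fin n → F) (i : ℕ) :
    (monicOfCoeffs n c).coeff i =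
      (if i = n then 1 else 0) + if h : i < n then c ⟨i, h⟩ else 0 := by
  rw [monicOfCoeffs, coeff_add, coeff_X_pow, finsetSum_coeff]
  congr 1
  simp only [coeff_C_mul_X_pow]
  split_ifs with h
  · rw [Finset.sum_eq_single ⟨i, h⟩]
    · simp
    · intro j _ hj
      rw [if_neg]
      rintro rfl
      exact hj rfl
    · simp
  · refine Finset.sum_eq_zero fun j _ => if_neg ?_
    have := j.2
    omega

lemma coeff_monicOfCoeffs {n : ℕ} (c : Fin n → F) (i : Fin n) :
    (monicOfCoeffs n c).coeff i = c i := by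
  rw [coeff_monicOfCoeffs_add, if_neg i.2.ne, dif_pos i.2, zero_add]

lemma monicOfCoeffs_injective (n : ℕ) : Function.Injective (monicOfCoeffs (F := F) n) := by
  intro c c' h
  funext i
  rw [← coeff_monicOfCoeffs c, h, coeff_monicOfCoeffs]

lemma monic_monicOfCoeffs {n : ℕ} (c : Fin n → F) : (monicOfCoeffs n c).Monic := by
  refine monic_of_natDegree_le_of_coeff_eq_one n ?_ ?_
  · rw [natDegree_le_iff_coeff_eq_zero]
    intro i hi
    rw [coeff_monicOfCoeffs_add, if_neg hi.ne', dif_neg hi.le.not_gt, zero_add]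
  · simp [coeff_monicOfCoeffs_add]

lemma natDegree_monicOfCoeffs {n : ℕ} (c : Fin n → F) : (monicOfCoeffs n c).natDegree = n := by
  refine natDegree_eq_of_le_of_coeff_ne_zero ?_ ?_
  · rw [natDegree_le_iff_coeff_eq_zero]
    intro i hi
    rw [coeff_monicOfCoeffs_add, if_neg hi.ne', dif_neg hi.le.not_gt, zero_add]
  · simp [coeff_monicOfCoeffs_add]

lemma monicOfCoeffs_coeff {f : F[X]} (hf : f.Monic) :
    monicOfCoeffs f.natDegree (fun i => f.coeff i) = f := by
  ext i
  rw [coeff_monicOfCoeffs_add]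
  rcases lt_trichotomy i f.natDegree with h | h | h
  · simp [h.ne, h]
  · subst h
    simp [hf.coeff_natDegree]
  · simp [h.ne', h.le.not_gt, coeff_eq_zero_of_natDegree_lt h]

variable (F) in
/-- The finite set of monic polynomials of degree `n`. -/
noncomputable def monicFinset [Fintype F] (n : ℕ) : Finset F[X] :=
  Finset.univ.image (monicOfCoeffs n)

variable [Fintype F]

lemma mem_monicFinset {n : ℕ} {f : F[X]} : f ∈ monicFinset F n ↔ f.Monic ∧ f.natDegree = n := by
  simp only [monicFinset, Finset.mem_image, Finset.mem_univ, true_and]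
  refine ⟨?_, ?_⟩
  · rintro ⟨c, rfl⟩
    exact ⟨monic_monicOfCoeffs c, natDegree_monicOfCoeffs c⟩
  · rintro ⟨hf, rfl⟩
    exact ⟨_, monicOfCoeffs_coeff hf⟩

lemma sum_monicFinset {M : Type*} [AddCommMonoid M] (n : ℕ) (φ : F[X] → M) :
    ∑ f ∈ monicFinset F n, φ f = ∑ c : Fin n → F, φ (monicOfCoeffs n c) :=
  Finset.sum_image fun _ _ _ _ h => monicOfCoeffs_injective n h

omit [Fintype F] in
lemma constantCoeff_reverse {f : F[X]} (hf : f.Monic) :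
    PowerSeries.constantCoeff (f.reverse : PowerSeries F) = 1 := by
  rw [← PowerSeries.coeff_zero_eq_constantCoeff_apply, coeff_coe, coeff_zero_reverse, hf]

lemma coeff_reverse_monicFinset {n : ℕ} {f : F[X]} (hf : f ∈ monicFinset F n) {j : ℕ}
    (hj : j ≤ n) : PowerSeries.coeff j (f.reverse : PowerSeries F) = f.coeff (n - j) := by
  rw [coeff_coe, coeff_reverse, (mem_monicFinset.1 hf).2, revAt_le hj]

namespace LeadingClass

variable {k : ℕ} {G : Type} [AddCommGroup G] (ρ : LeadingClass F k G)

/-- The character of monic polynomials induced by a character of the group of leading classes. -/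
noncomputable def char (ψ : AddChar G ℂ) (f : F[X]) : ℂ := ψ (ρ.cls (f.reverse : PowerSeries F))

omit [Fintype F] in
lemma char_one (ψ : AddChar G ℂ) : ρ.char ψ 1 = 1 := by
  have : (1 : F[X]).reverse = 1 := by rw [← C_1, reverse_C]
  rw [char, this, coe_one, ρ.cls_one, AddChar.map_zero_eq_one]

omit [Fintype F] in
lemma char_mul (ψ : AddChar G ℂ) {f g : F[X]} (hf : f.Monic) (hg : g.Monic) :
    ρ.char ψ (f * g) = ρ.char ψ f * ρ.char ψ g := by
  rw [char, reverse_mul_of_domain, coe_mul,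
    ρ.cls_mul _ _ (constantCoeff_reverse hf) (constantCoeff_reverse hg), AddChar.map_add_eq_mul]
  rfl

lemma sum_char_eq_zero {ψ : AddChar G ℂ} (hψ : ψ ≠ 1) {n : ℕ} (hn : k ≤ n) :
    ∑ f ∈ monicFinset F n, ρ.char ψ f = 0 := by
  obtain ⟨g, hg⟩ := AddChar.ne_one_iff.1 hψ
  obtain ⟨p, hp, rfl⟩ := ρ.exists_cls_eq g
  let R : (Fin n → F) → PowerSeries F := fun c => ((monicOfCoeffs n c).reverse : PowerSeries F)
  have hR1 : ∀ c, PowerSeries.constantCoeff (R c) = 1 := fun c =>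
    constantCoeff_reverse (monic_monicOfCoeffs c)
  have hmem : ∀ c : Fin n → F, monicOfCoeffs n c ∈ monicFinset F n := fun c =>
    Finset.mem_image_of_mem _ (Finset.mem_univ c)
  let τ : (Fin n → F) → Fin n → F := fun c i => PowerSeries.coeff (n - i) (p * R c)
  have hτ : ∀ c, ∀ j ≤ n, PowerSeries.coeff j (R (τ c)) = PowerSeries.coeff j (p * R c) := by
    intro c j hj
    rcases Nat.eq_zero_or_pos j with rfl | hj0
    · rw [PowerSeries.coeff_zero_eq_constantCoeff_apply,
        PowerSeries.coeff_zero_eq_constantCoeff_apply, hR1, map_mul, hp, hR1, one_mul]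
    · rw [coeff_reverse_monicFinset (hmem _) hj]
      have := coeff_monicOfCoeffs (τ c) ⟨n - j, by omega⟩
      simp only at this
      rw [this]
      simp only [τ]
      congr 2
      omega
  have hinj : Function.Injective τ := by
    intro c c' h
    have h1 : (PowerSeries.X : PowerSeries F) ^ (n + 1) ∣ p * (R c - R c') := by
      rw [PowerSeries.X_pow_dvd_iff]
      intro j hj
      rw [mul_sub, map_sub, ← hτ c j (by omega), ← hτ c' j (by omega), h, sub_self]
    have hu : IsUnit p := by
      rw [PowerSeries.isUnit_iff_constantCoeff, hp]; exact isUnit_one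
    rw [hu.dvd_mul_left, PowerSeries.X_pow_dvd_iff] at h1
    funext i
    have h2 := h1 (n - i) (by omega)
    have hi := i.2
    rw [map_sub, sub_eq_zero, coeff_reverse_monicFinset (hmem _) (by omega),
      coeff_reverse_monicFinset (hmem _) (by omega), show n - (n - (i : ℕ)) = i by omega,
      coeff_monicOfCoeffs, coeff_monicOfCoeffs] at h2
    exact h2
  have hval : ∀ c, ρ.char ψ (monicOfCoeffs n (τ c)) =
      ψ (ρ.cls p) * ρ.char ψ (monicOfCoeffs n c) := by
    intro c
    rw [char, char, ← AddChar.map_add_eq_mul, ← ρ.cls_mul p _ hp (hR1 c)]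
    congr 1
    refine (ρ.cls_eq_iff _ _ (hR1 _) ?_).2 fun j hj => hτ c j (hj.trans hn)
    rw [map_mul, hp, hR1, one_mul]
  have h1 := (Finite.injective_iff_bijective.1 hinj).sum_comp
    fun c => ρ.char ψ (monicOfCoeffs n c)
  rw [sum_monicFinset]
  simp only [hval] at h1
  rw [← Finset.mul_sum] at h1
  have h2 : (ψ (ρ.cls p) - 1) * ∑ c : Fin n → F, ρ.char ψ (monicOfCoeffs n c) = 0 := by
    linear_combination h1
  exact (mul_eq_zero.1 h2).resolve_left (sub_ne_zero.2 hg)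

end LeadingClass

end Monics

section MoebiusIdentity

open Polynomial UniqueFactorizationMonoid

variable {F : Type} [Field F]

lemma normalizedFactors_finset_prod {U : Finset F[X]} (hU : ∀ P ∈ U, Irreducible P ∧ P.Monic) :
    normalizedFactors (∏ P ∈ U, P) = U.val := by
  have := normalizedFactors_prod_eq U.val fun P hP => (hU P hP).1
  rw [Finset.prod, Multiset.map_id', this]
  conv_rhs => rw [← Multiset.map_id' U.val]
  exact Multiset.map_congr rfl fun P hP => (hU P hP).2.normalize_eq_self

lemma polyMoebius_finset_prod {U : Finset F[X]} (hU : ∀ P ∈ U, Irreducible P ∧ P.Monic) :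
    polyMoebius (∏ P ∈ U, P) = (-1) ^ U.card := by
  have h0 : ∏ P ∈ U, P ≠ 0 := Finset.prod_ne_zero_iff.2 fun P hP => (hU P hP).1.ne_zero
  rw [polyMoebius, if_pos, normalizedFactors_finset_prod hU, Finset.card_def]
  rw [squarefree_iff_nodup_normalizedFactors h0, normalizedFactors_finset_prod hU]
  exact U.nodup

lemma exists_finset_prod_eq {d f : F[X]} (hf : f ≠ 0) (hd : d.Monic) (hdf : d ∣ f)
    (hsq : Squarefree d) : ∃ U ⊆ (normalizedFactors f).toFinset, ∏ P ∈ U, P = d := by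
  refine ⟨(normalizedFactors d).toFinset, ?_, ?_⟩
  · rw [Multiset.toFinset_subset]
    exact Multiset.subset_of_le ((dvd_iff_normalizedFactors_le_normalizedFactors hd.ne_zero hf).1 hdf)
  · have h1 := (squarefree_iff_nodup_normalizedFactors hd.ne_zero).1 hsq
    have h2 := leadingCoeff_mul_prod_normalizedFactors d
    rw [hd, C_1, one_mul] at h2
    rw [Finset.prod, Multiset.toFinset_val, h1.dedup, Multiset.map_id', h2]

variable [Fintype F]

/-- The pairs of monic polynomials with degrees summing to `n`, tagged by the first degree. -/
noncomputable def monicPairs (F : Type) [Field F] [Fintype F] (n : ℕ) :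
    Finset (Σ _ : ℕ, F[X] × F[X]) :=
  (Finset.range (n + 1)).sigma fun i => monicFinset F i ×ˢ monicFinset F (n - i)

lemma mem_monicPairs {n : ℕ} {x : Σ _ : ℕ, F[X] × F[X]} : x ∈ monicPairs F n ↔
    x.1 ≤ n ∧ (x.2.1.Monic ∧ x.2.1.natDegree = x.1) ∧
      x.2.2.Monic ∧ x.2.2.natDegree = n - x.1 := by
  simp [monicPairs, mem_monicFinset]

lemma mul_mem_monicFinset {i n : ℕ} (hi : i ≤ n) {d e : F[X]} (hd : d ∈ monicFinset F i)
    (he : e ∈ monicFinset F (n - i)) : d * e ∈ monicFinset F n := by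
  rw [mem_monicFinset] at *
  refine ⟨hd.1.mul he.1, ?_⟩
  rw [hd.1.natDegree_mul he.1, hd.2, he.2]
  omega

lemma div_mem_monicFinset {n : ℕ} {d f : F[X]} (hd : d.Monic) (hf : f ∈ monicFinset F n)
    (hdf : d ∣ f) : d.natDegree ≤ n ∧ f / d ∈ monicFinset F (n - d.natDegree) := by
  rw [mem_monicFinset] at *
  obtain ⟨e, rfl⟩ := hdf
  have he : e.Monic := hd.of_mul_monic_left hf.1
  rw [mul_div_cancel_left₀ e hd.ne_zero]
  have := hf.2
  rw [hd.natDegree_mul he] at this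
  exact ⟨by omega, he, by omega⟩

lemma sum_polyMoebius_divisors {n : ℕ} (hn : 0 < n) {f : F[X]} (hf : f ∈ monicFinset F n) :
    ∑ x ∈ monicPairs F n with x.2.1 * x.2.2 = f, polyMoebius x.2.1 = 0 := by
  obtain ⟨hfm, hfd⟩ := mem_monicFinset.1 hf
  have hf0 := hfm.ne_zero
  have hU : ∀ U ∈ (normalizedFactors f).toFinset.powerset, ∀ P ∈ U, Irreducible P ∧ P.Monic := by
    intro U hU P hP
    have := Multiset.mem_toFinset.1 (Finset.mem_powerset.1 hU hP)
    rw [Polynomial.mem_normalizedFactors_iff hf0] at this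
    exact ⟨this.1, this.2.1⟩
  have hdvd : ∀ U ∈ (normalizedFactors f).toFinset.powerset, ∏ P ∈ U, P ∣ f := by
    intro U hU'
    rw [dvd_iff_normalizedFactors_le_normalizedFactors _ hf0,
      normalizedFactors_finset_prod (hU U hU')]
    · exact (Finset.val_le_iff.2 (Finset.mem_powerset.1 hU')).trans
        (Multiset.dedup_le (normalizedFactors f))
    · exact Finset.prod_ne_zero_iff.2 fun P hP => (hU U hU' P hP).1.ne_zero
  have hmonic : ∀ U ∈ (normalizedFactors f).toFinset.powerset, (∏ P ∈ U, P).Monic :=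
    fun U hU' => monic_prod_of_monic _ _ fun P hP => (hU U hU' P hP).2
  have hne : (normalizedFactors f).toFinset.Nonempty := by
    obtain ⟨P, hP, hPf⟩ := exists_monic_irreducible_factor f fun h => by
      have := natDegree_eq_zero_of_isUnit h
      omega
    exact ⟨P, Multiset.mem_toFinset.2 ((Polynomial.mem_normalizedFactors_iff hf0).2 ⟨hPf.1, hP, hPf.2⟩)⟩
  rw [← Finset.sum_powerset_neg_one_pow_card_of_nonempty hne, eq_comm]
  refine Finset.sum_of_injOn (fun U => ⟨(∏ P ∈ U, P).natDegree, ∏ P ∈ U, P, f / ∏ P ∈ U, P⟩)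
    ?_ ?_ ?_ fun U hU' => (polyMoebius_finset_prod (hU U hU')).symm
  · intro U hU' V hV h
    simp only [Sigma.mk.injEq, heq_eq_eq, Prod.mk.injEq] at h
    have := congrArg normalizedFactors h.2.1
    rw [normalizedFactors_finset_prod (hU U hU'), normalizedFactors_finset_prod (hU V hV)] at this
    exact Finset.val_injective this
  · intro U hU'
    have h1 := div_mem_monicFinset (hmonic U hU') hf (hdvd U hU')
    rw [mem_monicFinset] at h1
    rw [Finset.mem_coe, Finset.mem_filter, mem_monicPairs]
    exact ⟨⟨h1.1, ⟨hmonic U hU', rfl⟩, h1.2⟩,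
      EuclideanDomain.mul_div_cancel' (hmonic U hU').ne_zero (hdvd U hU')⟩
  · rintro ⟨i, d, e⟩ hx hnot
    rw [Finset.mem_filter, mem_monicPairs] at hx
    simp only at hx ⊢
    obtain ⟨⟨hi, ⟨hd, rfl⟩, he⟩, hde⟩ := hx
    rw [polyMoebius, if_neg]
    intro hsq
    obtain ⟨U, hU1, hU2⟩ := exists_finset_prod_eq hf0 hd ⟨e, hde.symm⟩ hsq
    refine hnot ⟨U, Finset.mem_powerset.2 hU1, ?_⟩
    simp only [hU2, ← hde]
    rw [mul_div_cancel_left₀ e hd.ne_zero]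

/-- The Dirichlet coefficients of a multiplicative function on monic polynomials and of its twist
by the Möbius function are inverse to each other. -/
lemma sum_moebius_mul_sum {χ : F[X] → ℂ}
    (hmul : ∀ f g : F[X], f.Monic → g.Monic → χ (f * g) = χ f * χ g) {n : ℕ} (hn : 0 < n) :
    ∑ i ∈ Finset.range (n + 1), (∑ f ∈ monicFinset F i, (polyMoebius f : ℂ) * χ f) *
      ∑ f ∈ monicFinset F (n - i), χ f = 0 := by
  have h1 : ∑ i ∈ Finset.range (n + 1), (∑ f ∈ monicFinset F i, (polyMoebius f : ℂ) * χ f) *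
      ∑ f ∈ monicFinset F (n - i), χ f =
      ∑ x ∈ monicPairs F n, (polyMoebius x.2.1 : ℂ) * χ (x.2.1 * x.2.2) := by
    rw [monicPairs, Finset.sum_sigma]
    refine Finset.sum_congr rfl fun i _ => ?_
    rw [Finset.sum_mul_sum, ← Finset.sum_product']
    refine Finset.sum_congr rfl fun x hx => ?_
    rw [Finset.mem_product, mem_monicFinset, mem_monicFinset] at hx
    rw [hmul _ _ hx.1.1 hx.2.1, mul_assoc]
  rw [h1, ← Finset.sum_fiberwise_of_maps_to (t := monicFinset F n) (g := fun x => x.2.1 * x.2.2)]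
  · refine Finset.sum_eq_zero fun f hf => ?_
    have h2 := sum_polyMoebius_divisors hn hf
    rw [Finset.sum_congr rfl fun x hx => by rw [(Finset.mem_filter.1 hx).2], ← Finset.sum_mul]
    rw [← Int.cast_sum, h2, Int.cast_zero, zero_mul]
  · intro x hx
    rw [mem_monicPairs] at hx
    exact mul_mem_monicFinset hx.1 (mem_monicFinset.2 hx.2.1) (mem_monicFinset.2 hx.2.2)

end MoebiusIdentity

section PowerSums

open Polynomial

variable (F : Type) [Field F] [Fintype F] (K : Type) [Field K] [Algebra F K]

/-- The elements of `K` fixed by the `r`-th power of the Frobenius map. -/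
noncomputable def frobFixed (r : ℕ) : Finset K :=
  (X ^ Fintype.card F ^ r - X : K[X]).roots.toFinset

variable {K}

omit [Algebra F K] in
lemma mem_frobFixed {r : ℕ} (hr : 0 < r) {a : K} :
    a ∈ frobFixed F K r ↔ a ^ Fintype.card F ^ r = a := by
  rw [frobFixed, Multiset.mem_toFinset, mem_roots
    (FiniteField.X_pow_card_pow_sub_X_ne_zero K hr.ne' Fintype.one_lt_card)]
  simp [sub_eq_zero]

variable (K) in
lemma card_frobFixed [IsAlgClosed K] {r : ℕ} (hr : 0 < r) :
    (frobFixed F K r).card = Fintype.card F ^ r := by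
  have : CharP K (ringChar F) := charP_of_injective_algebraMap (algebraMap F K).injective _
  have hdvd : ringChar F ∣ Fintype.card F ^ r := by
    refine dvd_pow ?_ hr.ne'
    rw [← CharP.cast_eq_zero_iff F (ringChar F)]
    exact FiniteField.cast_card_eq_zero F
  have h1 := nodup_roots (galois_poly_separable (K := K) (ringChar F) _ hdvd)
  rw [frobFixed, Multiset.toFinset_card_of_nodup h1, ← (IsAlgClosed.splits _).natDegree_eq_card_roots,
    FiniteField.X_pow_card_pow_sub_X_natDegree_eq K hr.ne' Fintype.one_lt_card]

/-- The characteristic polynomial of an element of the extension of degree `r` of `F`. -/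
noncomputable def frobCharpoly (r : ℕ) (a : K) : F[X] := minpoly F a ^ (r / frobDegree F a)

lemma frobCharpoly_mem_monicFinset {r : ℕ} (hr : 0 < r) {a : K} (ha : a ∈ frobFixed F K r) :
    frobCharpoly F r a ∈ monicFinset F r := by
  rw [mem_frobFixed F hr, ← frobDegree_dvd_iff] at ha
  have hd := Nat.pos_of_dvd_of_pos ha hr
  have hm := minpoly.monic (isIntegral_of_frobDegree_pos F hd)
  rw [mem_monicFinset, frobCharpoly, hm.natDegree_pow, natDegree_minpoly_eq_frobDegree F hd]
  exact ⟨hm.pow _, Nat.div_mul_cancel ha⟩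

lemma map_frobCharpoly {r : ℕ} (hr : 0 < r) {a : K} (ha : a ∈ frobFixed F K r) :
    (frobCharpoly F r a).map (algebraMap F K) =
      ∏ i ∈ Finset.range r, (X - C (a ^ Fintype.card F ^ i)) := by
  rw [mem_frobFixed F hr, ← frobDegree_dvd_iff] at ha
  have hd := Nat.pos_of_dvd_of_pos ha hr
  rw [frobCharpoly, map_minpoly_pow_eq_prod F hd, Nat.mul_div_cancel' ha]

omit [Fintype F] in
lemma map_reverse_algebraMap (f : F[X]) :
    f.reverse.map (algebraMap F K) = (f.map (algebraMap F K)).reverse := by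
  rw [reverse, reverse, reflect_map, natDegree_map]

lemma reverse_prod_X_sub_C {ι : Type*} (s : Finset ι) (b : ι → K) :
    (∏ i ∈ s, (X - C (b i))).reverse = ∏ i ∈ s, (1 - C (b i) * X) := by
  induction s using Finset.induction_on with
  | empty => rw [Finset.prod_empty, Finset.prod_empty, ← C_1, reverse_C]
  | insert i s hi ih =>
    rw [Finset.prod_insert hi, Finset.prod_insert hi, reverse_mul_of_domain, ih]
    congr 1
    rw [sub_eq_add_neg, ← C_neg, reverse_add_C, ← one_mul (X : K[X]), reverse_mul_X, ← C_1,
      reverse_C, C_neg, C_1, one_mul, natDegree_X, pow_one, neg_mul, ← sub_eq_add_neg]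

lemma coeff_prod_frobenius {r : ℕ} (hr : 0 < r) {a : K} (ha : a ∈ frobFixed F K r) (j : ℕ) :
    PowerSeries.coeff j (∏ i ∈ Finset.range r,
      (1 - PowerSeries.C (a ^ Fintype.card F ^ i) * PowerSeries.X : PowerSeries K)) =
    algebraMap F K (PowerSeries.coeff j ((frobCharpoly F r a).reverse : PowerSeries F)) := by
  rw [coeff_coe, ← coeff_map, map_reverse_algebraMap, map_frobCharpoly F hr ha,
    reverse_prod_X_sub_C, ← coeff_coe, ← coeToPowerSeries.ringHom_apply,
    map_prod coeToPowerSeries.ringHom]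
  simp

variable [IsAlgClosed K] [Algebra.IsAlgebraic F K]

/-- The pairs consisting of an element of the extension of degree `r` and a monic polynomial of
degree `n - r`, tagged by `1 ≤ r ≤ n`. -/
noncomputable def frobPairs (F : Type) [Field F] [Fintype F] (K : Type) [Field K] [Algebra F K]
    (n : ℕ) : Finset (Σ _ : ℕ, K × F[X]) :=
  (Finset.Icc 1 n).sigma fun r => frobFixed F K r ×ˢ monicFinset F (n - r)

lemma card_frobPairs {n : ℕ} {f : F[X]} (hf : f ∈ monicFinset F n) :
    ((frobPairs F K n).filter fun x => frobCharpoly F x.1 x.2.1 * x.2.2 = f).card = n := by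
  obtain ⟨hfm, hfd⟩ := mem_monicFinset.1 hf
  have hf0 := hfm.ne_zero
  let g := f.map (algebraMap F K)
  have h1 : (g.roots.toFinset.sigma fun a =>
      (Finset.Icc 1 n).filter fun m => minpoly F a ^ m ∣ f).card = n := by
    rw [Finset.card_sigma]
    simp_rw [card_minpoly_pow_dvd F _ hf0 hfd.le]
    have : ∑ a ∈ g.roots.toFinset, g.rootMultiplicity a = g.roots.card := by
      rw [← Multiset.toFinset_sum_count_eq]
      simp_rw [count_roots]
    rw [this, ← (IsAlgClosed.splits g).natDegree_eq_card_roots, natDegree_map, hfd]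
  refine Eq.trans ?_ h1
  have hmon : ∀ a : K, (minpoly F a).Monic := fun a => minpoly.monic (Algebra.IsIntegral.isIntegral a)
  refine Finset.card_nbij' (fun x => ⟨x.2.1, x.1 / frobDegree F x.2.1⟩)
    (fun y => ⟨frobDegree F y.1 * y.2, y.1, f / minpoly F y.1 ^ y.2⟩) ?_ ?_ ?_ ?_
  · rintro ⟨r, a, e⟩ hx
    simp only [frobPairs, Finset.coe_filter, Finset.mem_sigma, Finset.mem_product,
      Finset.mem_Icc, Set.mem_ofPred_eq] at hx
    obtain ⟨⟨hr, ha, he⟩, hx⟩ := hx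
    rw [mem_frobFixed F hr.1, ← frobDegree_dvd_iff] at ha
    have hd := Nat.pos_of_dvd_of_pos ha hr.1
    have hdvd : minpoly F a ^ (r / frobDegree F a) ∣ f := ⟨e, hx.symm⟩
    have hpos : 0 < r / frobDegree F a := Nat.div_pos (Nat.le_of_dvd hr.1 ha) hd
    simp only [Finset.coe_sigma, Set.mem_sigma_iff, Finset.mem_coe, Finset.mem_filter,
      Finset.mem_Icc, Multiset.mem_toFinset, g]
    refine ⟨?_, ⟨hpos, (Nat.div_le_self _ _).trans hr.2⟩, hdvd⟩
    rw [mem_roots (map_monic_ne_zero hfm), IsRoot.def, eval_map_algebraMap]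
    exact minpoly.dvd_iff.1 ((dvd_pow_self _ hpos.ne').trans hdvd)
  · rintro ⟨a, m⟩ hy
    simp only [Finset.coe_sigma, Set.mem_sigma_iff, Finset.mem_coe, Finset.mem_filter,
      Finset.mem_Icc] at hy
    obtain ⟨-, hm, hdvd⟩ := hy
    have hd := frobDegree_pos F a
    have h2 := div_mem_monicFinset ((hmon a).pow m) hf hdvd
    rw [(hmon a).natDegree_pow, natDegree_minpoly_eq_frobDegree F hd, mul_comm] at h2
    have hpos : 0 < frobDegree F a * m := Nat.mul_pos hd hm.1
    simp only [frobPairs, Finset.coe_filter, Finset.mem_sigma, Finset.mem_product,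
      Finset.mem_Icc, Set.mem_ofPred_eq]
    refine ⟨⟨⟨hpos, h2.1⟩, ?_, h2.2⟩, ?_⟩
    · rw [mem_frobFixed F hpos, ← frobDegree_dvd_iff]
      exact dvd_mul_right _ _
    · rw [frobCharpoly, Nat.mul_div_cancel_left _ hd]
      exact EuclideanDomain.mul_div_cancel' ((hmon a).pow m).ne_zero hdvd
  · rintro ⟨r, a, e⟩ hx
    simp only [frobPairs, Finset.coe_filter, Finset.mem_sigma, Finset.mem_product,
      Finset.mem_Icc, Set.mem_ofPred_eq] at hx
    obtain ⟨⟨hr, ha, he⟩, hx⟩ := hx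
    rw [mem_frobFixed F hr.1, ← frobDegree_dvd_iff] at ha
    simp only [Nat.mul_div_cancel' ha, Sigma.mk.injEq, heq_eq_eq, Prod.mk.injEq, true_and]
    rw [← hx, frobCharpoly, mul_div_cancel_left₀ _ ((hmon a).pow _).ne_zero]
  · rintro ⟨a, m⟩ hy
    simp only [Nat.mul_div_cancel_left _ (frobDegree_pos F a)]

variable {F}

/-- The Newton-type recursion for the sums of a multiplicative function over monic polynomials. -/
lemma nsmul_sum_monicFinset {χ : F[X] → ℂ}
    (hmul : ∀ f g : F[X], f.Monic → g.Monic → χ (f * g) = χ f * χ g) (n : ℕ) :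
    (n : ℂ) * ∑ f ∈ monicFinset F n, χ f =
      ∑ r ∈ Finset.Icc 1 n, (∑ a ∈ frobFixed F K r, χ (frobCharpoly F r a)) *
        ∑ f ∈ monicFinset F (n - r), χ f := by
  have h1 : ∑ r ∈ Finset.Icc 1 n, (∑ a ∈ frobFixed F K r, χ (frobCharpoly F r a)) *
        ∑ f ∈ monicFinset F (n - r), χ f =
      ∑ x ∈ frobPairs F K n, χ (frobCharpoly F x.1 x.2.1 * x.2.2) := by
    rw [frobPairs, Finset.sum_sigma]
    refine Finset.sum_congr rfl fun r hr => ?_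
    rw [Finset.sum_mul_sum, ← Finset.sum_product']
    refine Finset.sum_congr rfl fun x hx => ?_
    rw [Finset.mem_product, mem_monicFinset] at hx
    rw [hmul _ _ (mem_monicFinset.1 (frobCharpoly_mem_monicFinset F (Finset.mem_Icc.1 hr).1 hx.1)).1
      hx.2.1]
  rw [h1, ← Finset.sum_fiberwise_of_maps_to (t := monicFinset F n)
    (g := fun x : Σ _ : ℕ, K × F[X] => frobCharpoly F x.1 x.2.1 * x.2.2), Finset.mul_sum]
  · refine Finset.sum_congr rfl fun f hf => ?_
    rw [Finset.sum_congr rfl fun x hx => by rw [(Finset.mem_filter.1 hx).2], Finset.sum_const,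
      card_frobPairs F hf, nsmul_eq_mul]
  · rintro ⟨r, a, e⟩ hx
    simp only [frobPairs, Finset.mem_sigma, Finset.mem_product, Finset.mem_Icc] at hx
    exact mul_mem_monicFinset hx.1.2 (frobCharpoly_mem_monicFinset F hx.1.1 hx.2.1) hx.2.2

end PowerSums

section PowerSumBound

open Polynomial

lemma norm_sum_char_le {G : Type} [AddCommGroup G] [Fintype G] {ψ : AddChar G ℂ} (hψ : ψ ≠ 1)
    {ι : Type*} (s : Finset ι) (κ : ι → G) {T : ℝ}
    (hT : ∀ c, (((s.filter fun a => κ a = c).card : ℕ) : ℝ) ≤ T) :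
    ‖∑ a ∈ s, ψ (κ a)‖ ≤ Fintype.card G * T - s.card := by
  have h1 : ∑ a ∈ s, ψ (κ a) = ∑ c, ((s.filter fun a => κ a = c).card : ℂ) * ψ c := by
    rw [← Finset.sum_fiberwise s κ]
    refine Finset.sum_congr rfl fun c _ => ?_
    rw [Finset.sum_congr rfl fun x hx => by rw [(Finset.mem_filter.1 hx).2], Finset.sum_const,
      nsmul_eq_mul]
  have h2 : ∑ a ∈ s, ψ (κ a) = - ∑ c, (((T - (s.filter fun a => κ a = c).card : ℝ)) : ℂ) * ψ c := by
    have := AddChar.sum_eq_zero_of_ne_one hψ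
    push_cast
    simp_rw [sub_mul]
    rw [Finset.sum_sub_distrib, ← Finset.mul_sum, this, h1]
    ring
  have h3 : (∑ c, ((s.filter fun a => κ a = c).card : ℝ)) = s.card := by
    exact_mod_cast (Finset.card_eq_sum_card_fiberwise (f := κ) (t := Finset.univ)
      fun x _ => Finset.mem_univ _).symm
  rw [h2, norm_neg]
  refine (norm_sum_le _ _).trans ?_
  rw [← h3, ← nsmul_eq_mul, ← Finset.card_univ, ← Finset.sum_const, ← Finset.sum_sub_distrib]
  refine Finset.sum_le_sum fun c _ => ?_
  rw [norm_mul, AddChar.norm_apply, mul_one, Complex.norm_real, Real.norm_eq_abs,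
    abs_of_nonneg (sub_nonneg.2 (hT c))]

variable (F : Type) [Field F] [Fintype F] (K : Type) [Field K] [Algebra F K] [IsAlgClosed K]

lemma LeadingClass.exists_norm_sum_frobFixed_le {k : ℕ} {G : Type} [AddCommGroup G] [Finite G]
    (ρ : LeadingClass F k G) {ψ : AddChar G ℂ} (hψ : ψ ≠ 1) :
    ∃ D r₀ : ℕ, ∀ r ≥ r₀, ‖∑ a ∈ frobFixed F K r, ρ.char ψ (frobCharpoly F r a)‖ ≤
      D * (Fintype.card F : ℝ) ^ ((r + 1) / 2) := by
  have := Fintype.ofFinite G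
  obtain ⟨D, r₀, h⟩ := exists_card_frobenius_prod_le F K k
  refine ⟨D, r₀ + 1, fun r hr => ?_⟩
  have hr0 : 0 < r := by omega
  have hq : (0 : ℝ) < (Fintype.card F : ℝ) ^ k := by
    have : 0 < Fintype.card F := Fintype.card_pos
    positivity
  have hG : (Fintype.card G : ℝ) = (Fintype.card F : ℝ) ^ k := by
    rw [← Nat.card_eq_fintype_card, ρ.natCard_eq]
    push_cast
    rfl
  refine (norm_sum_char_le hψ (frobFixed F K r)
    (fun a => ρ.cls ((frobCharpoly F r a).reverse : PowerSeries F))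
    (T := ((Fintype.card F : ℝ) ^ r + D * (Fintype.card F : ℝ) ^ ((r + 1) / 2)) /
      (Fintype.card F : ℝ) ^ k) fun c => ?_).trans (le_of_eq ?_)
  · obtain ⟨p, hp, rfl⟩ := ρ.exists_cls_eq c
    rw [le_div_iff₀ hq, mul_comm]
    have := h r (by omega) (fun j => algebraMap F K (PowerSeries.coeff j p))
      (by simp [hp]) (fun j => by rw [← map_pow, FiniteField.pow_card])
      ((frobFixed F K r).filter fun a =>
        ρ.cls ((frobCharpoly F r a).reverse : PowerSeries F) = ρ.cls p) ?_
    · exact_mod_cast this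
    · intro a ha
      obtain ⟨ha, hcls⟩ := Finset.mem_filter.1 ha
      refine ⟨(mem_frobFixed F hr0).1 ha, fun j hj => ?_⟩
      rw [coeff_prod_frobenius F hr0 ha]
      congr 1
      exact (ρ.cls_eq_iff _ _ (constantCoeff_reverse
        (mem_monicFinset.1 (frobCharpoly_mem_monicFinset F hr0 ha)).1) hp).1 hcls j hj
  · rw [hG, mul_div_cancel₀ _ hq.ne', card_frobFixed F K hr0]
    push_cast
    ring

end PowerSumBound

section LogarithmicDerivative

open Polynomial Filter Topology

lemma tendsto_coeff_mul_pow {u : ℂ} {S : PowerSeries ℂ}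
    (hS : Tendsto (fun N => PowerSeries.coeff N S * u ^ N) atTop (𝓝 0)) (B : ℂ[X]) :
    Tendsto (fun N => PowerSeries.coeff N ((B : PowerSeries ℂ) * S) * u ^ N) atTop (𝓝 0) := by
  induction B using Polynomial.induction_on' with
  | add p q hp hq =>
    refine (by simpa using hp.add hq : Tendsto _ atTop (𝓝 (0 : ℂ))).congr fun N => ?_
    rw [coe_add, add_mul, map_add, add_mul]
  | monomial n a =>
    rw [← tendsto_add_atTop_iff_nat n]
    refine (by simpa using hS.const_mul (a * u ^ n) : Tendsto _ atTop (𝓝 (0 : ℂ))).congr fun N => ?_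
    rw [← C_mul_X_pow_eq_monomial, coe_mul, coe_pow, coe_X, coe_C, mul_assoc (PowerSeries.C a),
      PowerSeries.coeff_C_mul, PowerSeries.coeff_X_pow_mul, pow_add]
    ring

lemma eval_eq_zero_of_eq_mul {u : ℂ} {L : ℂ[X]} {T : PowerSeries ℂ}
    (hL : (L : PowerSeries ℂ) = ((X - C u : ℂ[X]) : PowerSeries ℂ) * T)
    (hT : Tendsto (fun N => PowerSeries.coeff N T * u ^ N) atTop (𝓝 0)) : L.eval u = 0 := by
  have h0 : L.coeff 0 = -(u * PowerSeries.coeff 0 T) := by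
    rw [← coeff_coe, hL, coe_sub, coe_X, coe_C, sub_mul, map_sub, PowerSeries.coeff_zero_X_mul,
      PowerSeries.coeff_C_mul, zero_sub]
  have h1 : ∀ j, L.coeff (j + 1) = PowerSeries.coeff j T - u * PowerSeries.coeff (j + 1) T := by
    intro j
    rw [← coeff_coe, hL, coe_sub, coe_X, coe_C, sub_mul, map_sub, PowerSeries.coeff_succ_X_mul,
      PowerSeries.coeff_C_mul]
  have h2 : ∀ N, ∑ j ∈ Finset.range (N + 1), L.coeff j * u ^ j =
      -u * (PowerSeries.coeff N T * u ^ N) := by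
    intro N
    induction N with
    | zero => simp [h0]
    | succ N ih =>
      rw [Finset.sum_range_succ, ih, h1]
      ring
  refine tendsto_nhds_unique (tendsto_const_nhds (f := atTop (α := ℕ)))
    ((by simpa using hT.const_mul (-u) : Tendsto _ atTop (𝓝 (0 : ℂ))).congr' ?_)
  filter_upwards [eventually_ge_atTop L.natDegree] with N hN
  rw [eval_eq_sum_range' (Nat.lt_succ_of_le hN), h2, neg_mul]

/-- A polynomial does not vanish where the power series of its logarithmic derivative converges. -/
lemma eval_ne_zero_of_logDeriv {P : ℂ[X]} (hP : P ≠ 0) {u : ℂ} (hu : u ≠ 0) {S : PowerSeries ℂ}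
    (h : ((X * derivative P : ℂ[X]) : PowerSeries ℂ) = (P : PowerSeries ℂ) * S)
    (hS : Tendsto (fun N => PowerSeries.coeff N S * u ^ N) atTop (𝓝 0)) : P.eval u ≠ 0 := by
  intro hroot
  obtain ⟨B, hB, hdvd⟩ := exists_eq_pow_rootMultiplicity_mul_and_not_dvd P hP u
  have hm := (rootMultiplicity_pos hP).2 hroot
  obtain ⟨m, hm'⟩ := Nat.exists_eq_succ_of_ne_zero hm.ne'
  rw [hm'] at hB
  have h1 : X * derivative P =
      (X - C u) ^ m * (X * (C (m + 1 : ℂ) * B + (X - C u) * derivative B)) := by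
    rw [hB, derivative_mul, derivative_X_sub_C_pow, Nat.succ_eq_add_one, Nat.add_sub_cancel]
    simp only [map_add, map_natCast, map_one, Nat.cast_add, Nat.cast_one, pow_succ]
    ring
  have h2 : ((X * (C (m + 1 : ℂ) * B + (X - C u) * derivative B) : ℂ[X]) : PowerSeries ℂ) =
      ((X - C u : ℂ[X]) : PowerSeries ℂ) * ((B : PowerSeries ℂ) * S) := by
    have h3 : (((X - C u) ^ m : ℂ[X]) : PowerSeries ℂ) ≠ 0 :=
      (Polynomial.coe_eq_zero_iff (R := ℂ)).not.2 (pow_ne_zero _ (X_sub_C_ne_zero u))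
    refine mul_left_cancel₀ h3 ?_
    rw [← coe_mul, ← h1, h, hB, pow_succ, coe_mul, coe_mul]
    ring
  have h4 := eval_eq_zero_of_eq_mul h2 (tendsto_coeff_mul_pow hS B)
  have h5 : (m + 1 : ℂ) ≠ 0 := by exact_mod_cast Nat.succ_ne_zero m
  simp only [eval_mul, eval_X, eval_add, eval_C, eval_sub, sub_self, zero_mul, add_zero,
    mul_eq_zero, hu, h5, false_or] at h4
  exact hdvd (dvd_iff_isRoot.2 h4)

/-- If the power sums of the inverse roots of a polynomial grow at most like `β ^ r`, then its
coefficients are at most a constant times `β ^ j`. -/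
lemma norm_coeff_le_of_logDeriv {P : ℂ[X]} (hP : P.coeff 0 = 1) {S : PowerSeries ℂ}
    (h : ((X * derivative P : ℂ[X]) : PowerSeries ℂ) = (P : PowerSeries ℂ) * S) {β : ℝ}
    (hβ : 0 < β) {D : ℝ} (hS : ∀ᶠ r in atTop, ‖PowerSeries.coeff r S‖ ≤ D * β ^ r) (j : ℕ) :
    ‖P.coeff j‖ ≤ 2 ^ P.natDegree * β ^ j := by
  have hP0 : P ≠ 0 := by
    rintro rfl
    simp at hP
  have hroots : ∀ z ∈ (P.reverse.map (RingHom.id ℂ)).roots, ‖z‖ ≤ β := by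
    intro z hz
    rw [Polynomial.map_id] at hz
    have hz' := (mem_roots'.1 hz).2
    rcases eq_or_ne z 0 with rfl | hz0
    · simpa using hβ.le
    by_contra! hlt
    let u := z⁻¹
    have hu : u ≠ 0 := inv_ne_zero hz0
    have huz : ‖u‖ * β < 1 := by
      rw [norm_inv, inv_mul_lt_iff₀ (norm_pos_iff.2 hz0), mul_one]
      exact hlt
    refine eval_ne_zero_of_logDeriv hP0 hu h ?_ ?_
    · have h1 : Tendsto (fun N => D * (‖u‖ * β) ^ N) atTop (𝓝 0) := by
        simpa using (tendsto_pow_atTop_nhds_zero_of_lt_one (by positivity) huz).const_mul D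
      refine squeeze_zero_norm' ?_ h1
      filter_upwards [hS] with N hN
      rw [norm_mul, norm_pow, mul_pow, mul_left_comm, mul_comm]
      gcongr
    · have : Invertible u := invertibleOfNonzero hu
      rw [← eval₂_id, ← eval₂_reverse_eq_zero_iff]
      have h3 : ⅟u = z := by simp [u]
      rw [h3, eval₂_id]
      exact hz'
  have hmonic : P.reverse.Monic := by
    rw [Monic, reverse_leadingCoeff, trailingCoeff_eq_coeff_zero (by simp [hP]), hP]
  have hdeg : P.reverse.natDegree = P.natDegree := by
    rw [reverse_natDegree, natTrailingDegree_eq_zero.2 (Or.inr (by simp [hP])), Nat.sub_zero]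
  rcases le_or_gt j P.natDegree with hj | hj
  · have := coeff_le_of_roots_le (p := P.reverse) (f := RingHom.id ℂ) (P.natDegree - j) hmonic
      (IsAlgClosed.splits _) hroots
    rw [Polynomial.map_id, hdeg, coeff_reverse, revAt_le (Nat.sub_le _ _), Nat.sub_sub_self hj,
      mul_comm] at this
    refine this.trans ?_
    gcongr
    exact_mod_cast Nat.choose_le_two_pow _ _
  · rw [coeff_eq_zero_of_natDegree_lt hj, norm_zero]
    positivity

/-- A recursion bound for the coefficients of the inverse of a power series. -/
lemma norm_le_of_convolution {A M : ℕ → ℂ} (hA0 : A 0 = 1) (hM0 : M 0 = 1)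
    (hAM : ∀ n, 0 < n → ∑ i ∈ Finset.range (n + 1), M i * A (n - i) = 0) {c β : ℝ} (hc : 0 ≤ c)
    (hβ : 0 ≤ β) (hA : ∀ j, ‖A j‖ ≤ c * β ^ j) (n : ℕ) : ‖M n‖ ≤ (c + 1) ^ n * β ^ n := by
  induction n using Nat.strong_induction_on with
  | _ n ih =>
    rcases Nat.eq_zero_or_pos n with rfl | hn
    · simp [hM0]
    · have h1 := hAM n hn
      rw [Finset.sum_range_succ, Nat.sub_self, hA0, mul_one, add_comm] at h1
      rw [eq_neg_of_add_eq_zero_left h1, norm_neg]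
      calc ‖∑ i ∈ Finset.range n, M i * A (n - i)‖
          ≤ ∑ i ∈ Finset.range n, (c + 1) ^ i * β ^ i * (c * β ^ (n - i)) := by
            refine (norm_sum_le _ _).trans (Finset.sum_le_sum fun i hi => ?_)
            rw [norm_mul]
            have := ih i (Finset.mem_range.1 hi)
            have := hA (n - i)
            gcongr
        _ = ((∑ i ∈ Finset.range n, (c + 1) ^ i) * (c + 1 - 1)) * β ^ n := by
            rw [add_sub_cancel_right, Finset.sum_mul, Finset.sum_mul]
            refine Finset.sum_congr rfl fun i hi => ?_
            rw [← Nat.add_sub_of_le (Finset.mem_range.1 hi).le, pow_add, Nat.add_sub_cancel_left]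
            ring
        _ ≤ (c + 1) ^ n * β ^ n := by
            rw [geom_sum_mul]
            gcongr
            linarith

end LogarithmicDerivative

section MoebiusSums

open Polynomial Filter

variable {F : Type} [Field F] [Fintype F]

omit [Fintype F] in
lemma polyMoebius_one : polyMoebius (1 : F[X]) = 1 := by
  simp [polyMoebius]

omit [Fintype F] in
lemma abs_polyMoebius_le (f : F[X]) : |(polyMoebius f : ℝ)| ≤ 1 := by
  rw [polyMoebius]
  split_ifs <;> simp

lemma card_monicFinset (n : ℕ) : (monicFinset F n).card = Fintype.card F ^ n := by
  rw [Finset.card_eq_sum_ones, sum_monicFinset]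
  simp

lemma monicFinset_zero : monicFinset F 0 = {1} := by
  ext f
  rw [mem_monicFinset, Finset.mem_singleton]
  exact ⟨fun h => h.1.natDegree_eq_zero.1 h.2, fun h => by simp [h]⟩

lemma sum_polyMoebius_eq_zero {n : ℕ} (hn : 2 ≤ n) :
    ∑ f ∈ monicFinset F n, (polyMoebius f : ℂ) = 0 := by
  have h := fun m (hm : 0 < m) =>
    sum_moebius_mul_sum (F := F) (χ := fun _ => 1) (fun _ _ _ _ => (one_mul 1).symm) hm
  simp only [mul_one, Finset.sum_const, card_monicFinset, nsmul_eq_mul, Nat.cast_pow] at h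
  obtain ⟨m, rfl⟩ := Nat.exists_eq_add_of_le' (show 1 ≤ n by omega)
  have h1 := h (m + 1) (by omega)
  rw [Finset.sum_range_succ, Nat.sub_self, pow_zero, mul_one,
    Finset.sum_congr rfl fun i hi => by
      rw [Nat.succ_sub (Nat.lt_succ_iff.1 (Finset.mem_range.1 hi)), pow_succ, ← mul_assoc],
    ← Finset.sum_mul, h m (by omega), zero_mul, zero_add] at h1
  exact h1

/-- Square-root cancellation for the Möbius function twisted by a nontrivial character. -/
lemma LeadingClass.norm_sum_moebius_char_le {k : ℕ} {G : Type} [AddCommGroup G] [Finite G]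
    (ρ : LeadingClass F k G) {ψ : AddChar G ℂ} (hψ : ψ ≠ 1) (n : ℕ) :
    ‖∑ f ∈ monicFinset F n, (polyMoebius f : ℂ) * ρ.char ψ f‖ ≤
      (2 ^ k + 1) ^ n * √(Fintype.card F) ^ n := by
  let K := AlgebraicClosure F
  let A : ℕ → ℂ := fun j => ∑ f ∈ monicFinset F j, ρ.char ψ f
  let s : ℕ → ℂ := fun r => ∑ a ∈ frobFixed F K r, ρ.char ψ (frobCharpoly F r a)
  let P : ℂ[X] := ∑ j ∈ Finset.range k, monomial j (A j)
  let S : PowerSeries ℂ := PowerSeries.mk fun r => if r = 0 then 0 else s r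
  have hq : (0 : ℝ) < Fintype.card F := by exact_mod_cast Fintype.card_pos
  have hq1 : (1 : ℝ) ≤ √(Fintype.card F) := by
    rw [Real.one_le_sqrt]
    exact_mod_cast Fintype.card_pos
  have hmul : ∀ f g : F[X], f.Monic → g.Monic → ρ.char ψ (f * g) = ρ.char ψ f * ρ.char ψ g :=
    fun f g => ρ.char_mul ψ
  have hA0 : A 0 = 1 := by
    simp only [A, monicFinset_zero, Finset.sum_singleton, ρ.char_one]
  have hcoeff : ∀ j, P.coeff j = A j := by
    intro j
    simp only [P, finsetSum_coeff, coeff_monomial, Finset.sum_ite_eq', Finset.mem_range]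
    split_ifs with hj
    · rfl
    · exact (ρ.sum_char_eq_zero hψ (not_lt.1 hj)).symm
  have hdeg : P.natDegree ≤ k := by
    rw [natDegree_le_iff_coeff_eq_zero]
    intro j hj
    rw [hcoeff]
    exact ρ.sum_char_eq_zero hψ hj.le
  have hlog : ((X * derivative P : ℂ[X]) : PowerSeries ℂ) = (P : PowerSeries ℂ) * S := by
    ext j
    have h1 : PowerSeries.coeff j ((X * derivative P : ℂ[X]) : PowerSeries ℂ) = j * A j := by
      rw [coeff_coe]
      rcases j with _ | j
      · simp
      · rw [coeff_X_mul, coeff_derivative, hcoeff]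
        push_cast
        ring
    rw [h1, nsmul_sum_monicFinset (K := K) hmul, mul_comm, PowerSeries.coeff_mul,
      Finset.Nat.sum_antidiagonal_eq_sum_range_succ
        (fun a b => PowerSeries.coeff a S * PowerSeries.coeff b (P : PowerSeries ℂ))]
    refine Finset.sum_subset_zero_on_sdiff (fun r hr => ?_) (fun r hr => ?_) fun r hr => ?_
    · rw [Finset.mem_Icc] at hr
      exact Finset.mem_range.2 (by omega)
    · rw [Finset.mem_sdiff, Finset.mem_Icc, Finset.mem_range] at hr
      have : r = 0 := by omega
      simp [S, this]
    · rw [Finset.mem_Icc] at hr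
      rw [coeff_coe, hcoeff, PowerSeries.coeff_mk, if_neg (by omega)]
  have hS : ∃ D : ℝ, ∀ᶠ r in atTop, ‖PowerSeries.coeff r S‖ ≤ D * √(Fintype.card F) ^ r := by
    obtain ⟨D, r₀, hD⟩ := ρ.exists_norm_sum_frobFixed_le F K hψ
    refine ⟨D * √(Fintype.card F), ?_⟩
    filter_upwards [eventually_ge_atTop (r₀ + 1)] with r hr
    rw [PowerSeries.coeff_mk, if_neg (by omega)]
    refine (hD r (by omega)).trans ?_
    rw [mul_assoc, ← pow_succ']
    refine mul_le_mul_of_nonneg_left ?_ (Nat.cast_nonneg D)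
    calc (Fintype.card F : ℝ) ^ ((r + 1) / 2) = √(Fintype.card F) ^ (2 * ((r + 1) / 2)) := by
          rw [pow_mul, Real.sq_sqrt hq.le]
      _ ≤ √(Fintype.card F) ^ (r + 1) := pow_le_pow_right₀ hq1 (by omega)
  obtain ⟨D, hD⟩ := hS
  refine norm_le_of_convolution (A := A)
    (M := fun n => ∑ f ∈ monicFinset F n, (polyMoebius f : ℂ) * ρ.char ψ f) hA0 ?_
    (fun m hm => sum_moebius_mul_sum hmul hm) (by positivity) (Real.sqrt_nonneg _)
    (fun j => ?_) n
  · simp [monicFinset_zero, polyMoebius_one, ρ.char_one]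
  · rw [← hcoeff]
    refine (norm_coeff_le_of_logDeriv ((hcoeff 0).trans hA0) hlog
      (zero_lt_one.trans_le hq1) hD j).trans ?_
    gcongr
    norm_num

lemma sum_sq_le_of_norm_fourier_le {G : Type} [AddCommGroup G] [Fintype G] (T : G → ℝ) {B : ℝ}
    (hB : ∀ ψ : AddChar G ℂ, ‖∑ c, (T c : ℂ) * ψ c‖ ≤ B) : ∑ c, T c ^ 2 ≤ B ^ 2 := by
  have h1 : ∑ ψ : AddChar G ℂ, ((‖∑ c, (T c : ℂ) * ψ c‖ ^ 2 : ℝ) : ℂ) =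
      Fintype.card G * ∑ c, (T c : ℂ) ^ 2 := by
    have : ∀ ψ : AddChar G ℂ, ((‖∑ c, (T c : ℂ) * ψ c‖ ^ 2 : ℝ) : ℂ) =
        ∑ c, ∑ d, (T c : ℂ) * T d * ψ (c - d) := by
      intro ψ
      rw [Complex.ofReal_pow, ← Complex.mul_conj', map_sum, Finset.sum_mul_sum]
      refine Finset.sum_congr rfl fun c _ => Finset.sum_congr rfl fun d _ => ?_
      rw [map_mul, Complex.conj_ofReal, sub_eq_add_neg, AddChar.map_add_eq_mul,
        AddChar.map_neg_eq_conj]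
      ring
    simp_rw [this]
    rw [Finset.sum_comm, Finset.mul_sum]
    refine Finset.sum_congr rfl fun c _ => ?_
    rw [Finset.sum_comm]
    simp_rw [← Finset.mul_sum, AddChar.sum_apply_eq_ite, sub_eq_zero]
    simp
    ring
  have h2 : ∑ ψ : AddChar G ℂ, ‖∑ c, (T c : ℂ) * ψ c‖ ^ 2 = Fintype.card G * ∑ c, T c ^ 2 := by
    exact_mod_cast h1
  have h3 : ∑ ψ : AddChar G ℂ, ‖∑ c, (T c : ℂ) * ψ c‖ ^ 2 ≤ Fintype.card G * B ^ 2 := by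
    rw [← AddChar.card_eq (α := G), ← nsmul_eq_mul, ← Finset.card_univ, ← Finset.sum_const]
    refine Finset.sum_le_sum fun ψ _ => ?_
    have := hB ψ
    gcongr
  rw [h2] at h3
  exact le_of_mul_le_mul_left h3 (by exact_mod_cast Fintype.card_pos)

omit [Fintype F] in
lemma coeff_sum_C_mul_X_pow {n : ℕ} (a : Fin n → F) (i : ℕ) :
    (∑ j : Fin n, C (a j) * X ^ (j : ℕ)).coeff i = if h : i < n then a ⟨i, h⟩ else 0 := by
  have h := coeff_monicOfCoeffs_add a i
  rw [monicOfCoeffs, coeff_add, coeff_X_pow] at h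
  exact add_left_cancel h

/-- Short intervals of monic polynomials are the fibers of the leading class. -/
lemma LeadingClass.image_add_eq {n h : ℕ} (hh : h < n) {G : Type} [AddCommGroup G]
    (ρ : LeadingClass F (n - h - 1) G) {f : F[X]} (hf : f ∈ monicFinset F n) :
    (Finset.univ.image fun a : Fin (h + 1) → F => f + ∑ j : Fin (h + 1), C (a j) * X ^ (j : ℕ)) =
      (monicFinset F n).filter fun g =>
        ρ.cls (g.reverse : PowerSeries F) = ρ.cls (f.reverse : PowerSeries F) := by
  ext g
  simp only [Finset.mem_image, Finset.mem_univ, true_and, Finset.mem_filter]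
  have hfm := mem_monicFinset.1 hf
  refine ⟨?_, ?_⟩
  · rintro ⟨a, rfl⟩
    have hg : f + ∑ j : Fin (h + 1), C (a j) * X ^ (j : ℕ) ∈ monicFinset F n := by
      have hc : ∀ i, n ≤ i →
          (f + ∑ j : Fin (h + 1), C (a j) * X ^ (j : ℕ)).coeff i = f.coeff i := fun i hi => by
        rw [coeff_add, coeff_sum_C_mul_X_pow, dif_neg (by omega), add_zero]
      have h1 := (hc n le_rfl).trans (hfm.2 ▸ hfm.1.coeff_natDegree)
      have h2 : (f + ∑ j : Fin (h + 1), C (a j) * X ^ (j : ℕ)).natDegree ≤ n := by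
        rw [natDegree_le_iff_coeff_eq_zero]
        intro i hi
        rw [hc i hi.le, coeff_eq_zero_of_natDegree_lt (hfm.2 ▸ hi)]
      exact mem_monicFinset.2 ⟨monic_of_natDegree_le_of_coeff_eq_one n h2 h1,
        natDegree_eq_of_le_of_coeff_ne_zero h2 (h1 ▸ one_ne_zero)⟩
    refine ⟨hg, (ρ.cls_eq_iff _ _ (constantCoeff_reverse (mem_monicFinset.1 hg).1)
      (constantCoeff_reverse hfm.1)).2 fun j hj => ?_⟩
    rw [coeff_reverse_monicFinset hg (by omega), coeff_reverse_monicFinset hf (by omega),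
      coeff_add, coeff_sum_C_mul_X_pow, dif_neg (by omega), add_zero]
  · rintro ⟨hg, hcls⟩
    have hgm := mem_monicFinset.1 hg
    have h1 := (ρ.cls_eq_iff _ _ (constantCoeff_reverse hgm.1) (constantCoeff_reverse hfm.1)).1 hcls
    refine ⟨fun i => g.coeff i - f.coeff i, ?_⟩
    ext i
    rw [coeff_add, coeff_sum_C_mul_X_pow]
    split_ifs with hi
    · simp
    · rcases le_or_gt i n with hin | hin
      · have := h1 (n - i) (by omega)
        rw [coeff_reverse_monicFinset hg (by omega), coeff_reverse_monicFinset hf (by omega),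
          Nat.sub_sub_self hin] at this
        rw [this, add_zero]
      · rw [coeff_eq_zero_of_natDegree_lt (by omega), coeff_eq_zero_of_natDegree_lt (by omega),
          add_zero]

omit [Fintype F] in
lemma add_sum_C_mul_X_pow_injective (n : ℕ) (f : F[X]) :
    Function.Injective fun a : Fin n → F => f + ∑ j : Fin n, C (a j) * X ^ (j : ℕ) := by
  intro a b hab
  refine monicOfCoeffs_injective n ?_
  simp only [monicOfCoeffs, add_left_cancel hab]

/-- The second moment of sums of the Möbius function over short intervals. -/
lemma sum_sq_sum_polyMoebius_le {n h : ℕ} (hn : 2 ≤ n) (hh : h < n) :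
    ∑ f ∈ monicFinset F n, (∑ a : Fin (h + 1) → F,
      (polyMoebius (f + ∑ j : Fin (h + 1), C (a j) * X ^ (j : ℕ)) : ℝ)) ^ 2 ≤
    ((2 ^ (n - h - 1) + 1) ^ n) ^ 2 * (Fintype.card F : ℝ) ^ n *
      (Fintype.card F : ℝ) ^ (h + 1) := by
  obtain ⟨G, _, ⟨ρ⟩⟩ := exists_leadingClass F (n - h - 1)
  have : Finite G := Nat.finite_of_card_ne_zero (by
    rw [ρ.natCard_eq]
    exact pow_ne_zero _ Fintype.card_ne_zero)
  have := Fintype.ofFinite G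
  let κ : F[X] → G := fun f => ρ.cls (f.reverse : PowerSeries F)
  let T : G → ℝ := fun c => ∑ f ∈ monicFinset F n with κ f = c, (polyMoebius f : ℝ)
  have hcard : ∀ c, (((monicFinset F n).filter fun f => κ f = c).card : ℝ) ≤
      (Fintype.card F : ℝ) ^ (h + 1) := by
    intro c
    rcases ((monicFinset F n).filter fun f => κ f = c).eq_empty_or_nonempty with h0 | ⟨f, hf⟩
    · rw [h0]
      simp
    · obtain ⟨hf', rfl⟩ := Finset.mem_filter.1 hf
      rw [← ρ.image_add_eq hh hf']
      exact_mod_cast Finset.card_image_le.trans (by simp)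
  have hinner : ∀ f ∈ monicFinset F n, ∑ a : Fin (h + 1) → F,
      (polyMoebius (f + ∑ j : Fin (h + 1), C (a j) * X ^ (j : ℕ)) : ℝ) = T (κ f) := by
    intro f hf
    simp only [T, κ]
    rw [← ρ.image_add_eq hh hf,
      Finset.sum_image fun _ _ _ _ hab => add_sum_C_mul_X_pow_injective _ f hab]
  have hT : ∑ c, T c ^ 2 ≤ ((2 ^ (n - h - 1) + 1) ^ n * √(Fintype.card F) ^ n) ^ 2 := by
    refine sum_sq_le_of_norm_fourier_le T fun ψ => ?_
    have h1 : ∑ c, (T c : ℂ) * ψ c = ∑ f ∈ monicFinset F n, (polyMoebius f : ℂ) * ρ.char ψ f := by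
      rw [← Finset.sum_fiberwise (monicFinset F n) κ]
      refine Finset.sum_congr rfl fun c _ => ?_
      simp only [T]
      push_cast
      rw [Finset.sum_mul]
      refine Finset.sum_congr rfl fun f hf => ?_
      rw [← (Finset.mem_filter.1 hf).2]
      rfl
    rw [h1]
    by_cases hψ : ψ = 1
    · have h2 : ∀ f, ρ.char ψ f = 1 := fun f => by rw [hψ]; rfl
      simp only [h2, mul_one]
      rw [sum_polyMoebius_eq_zero hn, norm_zero]
      positivity
    · exact ρ.norm_sum_moebius_char_le hψ n
  calc _ = ∑ f ∈ monicFinset F n, T (κ f) ^ 2 :=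
        Finset.sum_congr rfl fun f hf => by rw [hinner f hf]
    _ = ∑ c, (((monicFinset F n).filter fun f => κ f = c).card : ℝ) * T c ^ 2 := by
        rw [← Finset.sum_fiberwise (monicFinset F n) κ]
        refine Finset.sum_congr rfl fun c _ => ?_
        rw [Finset.sum_congr rfl fun f hf => by rw [(Finset.mem_filter.1 hf).2], Finset.sum_const,
          nsmul_eq_mul]
    _ ≤ ∑ c, (Fintype.card F : ℝ) ^ (h + 1) * T c ^ 2 :=
        Finset.sum_le_sum fun c _ => mul_le_mul_of_nonneg_right (hcard c) (sq_nonneg _)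
    _ ≤ (Fintype.card F : ℝ) ^ (h + 1) *
          ((2 ^ (n - h - 1) + 1) ^ n * √(Fintype.card F) ^ n) ^ 2 := by
        rw [← Finset.mul_sum]
        exact mul_le_mul_of_nonneg_left hT (by positivity)
    _ = _ := by
        rw [mul_pow, ← pow_mul √_, mul_comm n 2, pow_mul √_, Real.sq_sqrt (Nat.cast_nonneg _)]
        ring

end MoebiusSums

/-- Fix `m ≥ 2`, `n ≥ 4`, `1 ≤ h ≤ n - 3`. There is a `C > 0` such that
for every finite field `F` with `q` elements (of characteristic `> n` when `m > 2`),
`|q⁻ⁿ ∑_{f ∈ M_n(F)} (∑_{deg g ≤ h} μ(f + g))^m| ≤ C q^{(h+1)(m-1)}`. -/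
theorem moments_polyMoebius (m n h : ℕ) (hm : 2 ≤ m) (hn : 4 ≤ n) (hh1 : 1 ≤ h)
    (hh2 : h ≤ n - 3) :
    ∃ C : ℝ, 0 < C ∧ ∀ (F : Type) [Field F] [Fintype F], (2 < m → n < ringChar F) →
      |(1 / (Fintype.card F : ℝ) ^ n) *
          (∑ co : Fin n → F, (∑ a : Fin (h + 1) → F,
            (polyMoebius (monicOfCoeffs n co +
              ∑ j : Fin (h + 1), Polynomial.C (a j) * Polynomial.X ^ (j : ℕ)) : ℝ)) ^ m)| ≤
      C * (Fintype.card F : ℝ) ^ ((h + 1) * (m - 1)) := by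
  refine ⟨((2 ^ (n - h - 1) + 1) ^ n) ^ 2, by positivity, fun F _ _ _ => ?_⟩
  let I : Polynomial F → ℝ := fun f => ∑ a : Fin (h + 1) → F,
    (polyMoebius (f + ∑ j : Fin (h + 1), Polynomial.C (a j) * Polynomial.X ^ (j : ℕ)) : ℝ)
  have hq : (0 : ℝ) < Fintype.card F := by exact_mod_cast Fintype.card_pos
  have hI : ∀ f, |I f| ≤ (Fintype.card F : ℝ) ^ (h + 1) := by
    intro f
    refine (Finset.abs_sum_le_sum_abs _ _).trans
      ((Finset.sum_le_sum fun a _ => abs_polyMoebius_le _).trans (le_of_eq ?_))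
    simp
  have h2 := sum_sq_sum_polyMoebius_le (F := F) (n := n) (h := h) (by omega) (by omega)
  rw [← sum_monicFinset n fun f => I f ^ m, abs_mul, abs_of_pos (by positivity : (0 : ℝ) < 1 / (Fintype.card F : ℝ) ^ n),
    one_div, inv_mul_le_iff₀ (by positivity)]
  calc |∑ f ∈ monicFinset F n, I f ^ m|
      ≤ ∑ f ∈ monicFinset F n, ((Fintype.card F : ℝ) ^ (h + 1)) ^ (m - 2) * I f ^ 2 := by
        refine (Finset.abs_sum_le_sum_abs _ _).trans (Finset.sum_le_sum fun f _ => ?_)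
        have : |I f| ^ m = |I f| ^ (m - 2) * |I f| ^ 2 := by rw [← pow_add, Nat.sub_add_cancel hm]
        rw [abs_pow, this, sq_abs]
        exact mul_le_mul_of_nonneg_right (pow_le_pow_left₀ (abs_nonneg _) (hI f) _) (sq_nonneg _)
    _ ≤ ((Fintype.card F : ℝ) ^ (h + 1)) ^ (m - 2) *
          (((2 ^ (n - h - 1) + 1) ^ n) ^ 2 * (Fintype.card F : ℝ) ^ n *
            (Fintype.card F : ℝ) ^ (h + 1)) := by
        rw [← Finset.mul_sum]
        exact mul_le_mul_of_nonneg_left h2 (by positivity)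
    _ = _ := by
        obtain ⟨l, rfl⟩ := Nat.exists_eq_add_of_le' hm
        rw [show l + 2 - 1 = l + 1 by omega, Nat.add_sub_cancel, ← pow_mul, Nat.mul_succ, pow_add]
        ring
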